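/- Fix an integer g ≥ 0 and a sequence (k_n) of integers with 0 ≤ k_n ≤ n−1+2g and k_n/√n → ∞ as n → ∞. For n ≥ 2, let F be a uniformly random element of 𝔽ₙᵍ and let f_{k_n} denote its prefix consisting of its first k_n transpositions. Then the probability that G(f_{k_n}) = g tends to 1 as n → ∞. -/

import Mathlib

open Filter

/-- Left-to-right product of a list of permutations: the leftmost entry is applied first. -/
def prodLR {n : ℕ} (l : List (Equiv.Perm (Fin n))) : Equiv.Perm (Fin n) :=
  l.reverse.prod

/-- The set `𝔽ₙᵍ` of genus-`g` factorizations of the `n`-cycle `(1 2 ⋯ n)`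
into transpositions. -/
def Fcal (n g : ℕ) : Set (List (Equiv.Perm (Fin n))) :=
  {l | l.length = n - 1 + 2 * g ∧ (∀ t ∈ l, t.IsSwap) ∧ prodLR l = finRotate n}

/-- The genus of a partial factorization: the least `g` such that it extends to an
element of `𝔽ₙᵍ`. -/
noncomputable def genus (n : ℕ) (f : List (Equiv.Perm (Fin n))) : ℕ :=
  sInf {g | ∃ l, f <+: l ∧ l ∈ Fcal n g}

section part1
open Matrix
set_option linter.unusedSimpArgs false

/-- sum over swaps -/
noncomputable def swapsF (n : ℕ) : Finset (Equiv.Perm (Fin n)) := by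
  classical exact Finset.univ.filter (fun t => t.IsSwap)

lemma mem_swapsF {n : ℕ} (t : Equiv.Perm (Fin n)) : t ∈ swapsF n ↔ t.IsSwap := by
  classical simp [swapsF]

lemma sum_swapsF_lt {n : ℕ} {M : Type*} [AddCommMonoid M] (f : Equiv.Perm (Fin n) → M) :
    ∑ t ∈ swapsF n, f t =
      ∑ p ∈ (Finset.univ : Finset (Fin n × Fin n)).filter (fun p => p.1 < p.2),
        f (Equiv.swap p.1 p.2) := by
  classical
  symm
  refine Finset.sum_bij (fun p _ => Equiv.swap p.1 p.2) ?_ ?_ ?_ ?_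
  · intro p hp
    rw [mem_swapsF]
    exact ⟨p.1, p.2, (Finset.mem_filter.1 hp).2.ne, rfl⟩
  · rintro ⟨a, b⟩ hp ⟨c, d⟩ hq h
    have h1 : a < b := (Finset.mem_filter.1 hp).2
    have h2 : c < d := (Finset.mem_filter.1 hq).2
    simp only at h
    have e1 : Equiv.swap c d a = b := by rw [← h]; simp
    have e2 : Equiv.swap c d b = a := by rw [← h]; simp
    rw [Equiv.swap_apply_def] at e1 e2
    have hx : a = c ∧ b = d := by
      split_ifs at e1 e2 <;> (try subst_vars) <;> omega
    rw [hx.1, hx.2]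
  · intro t ht
    rw [mem_swapsF] at ht
    obtain ⟨x, y, hxy, rfl⟩ := ht
    rcases lt_or_gt_of_ne hxy with h | h
    · exact ⟨(x, y), by simpa using h, rfl⟩
    · exact ⟨(y, x), by simpa using h, Equiv.swap_comm _ _⟩
  · intro p _; rfl

lemma two_mul_sum_swapsF {n : ℕ} {R : Type*} [CommRing R] (f : Equiv.Perm (Fin n) → R)
    (g : Fin n → Fin n → R) (hg : ∀ a b, g a b = g b a) (hg0 : ∀ a, g a a = 0)
    (hfg : ∀ a b, a ≠ b → f (Equiv.swap a b) = g a b) :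
    2 * ∑ t ∈ swapsF n, f t = ∑ a, ∑ b, g a b := by
  classical
  rw [sum_swapsF_lt]
  have h1 : ∑ p ∈ (Finset.univ : Finset (Fin n × Fin n)).filter (fun p => p.1 < p.2),
        f (Equiv.swap p.1 p.2) = ∑ a, ∑ b, if a < b then g a b else 0 := by
    rw [Finset.sum_filter, ← Finset.univ_product_univ, Finset.sum_product]
    refine Finset.sum_congr rfl fun a _ => Finset.sum_congr rfl fun b _ => ?_
    split_ifs with h
    · exact hfg _ _ h.ne
    · rfl
  have h2 : ∑ a, ∑ b, (if a < b then g a b else 0) = ∑ a, ∑ b, if b < a then g a b else 0 := by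
    rw [Finset.sum_comm]
    refine Finset.sum_congr rfl fun a _ => Finset.sum_congr rfl fun b _ => ?_
    rw [hg]
  rw [h1, two_mul]
  nth_rw 2 [h2]
  simp only [← Finset.sum_add_distrib]
  refine Finset.sum_congr rfl fun a _ => Finset.sum_congr rfl fun b _ => ?_
  rcases lt_trichotomy a b with h | h | h
  · simp [h, h.not_gt]
  · subst h; simp [hg0]
  · simp [h, h.not_gt]

variable {R : Type*} [CommRing R] {n : ℕ}

/-- permutation matrix -/
def PM (R : Type*) [CommRing R] {n : ℕ} (σ : Equiv.Perm (Fin n)) : Matrix (Fin n) (Fin n) R :=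
  Matrix.of fun i j => if i = σ j then 1 else 0

lemma PM_apply (σ : Equiv.Perm (Fin n)) (i j : Fin n) :
    PM R σ i j = if i = σ j then 1 else 0 := rfl

lemma PM_mul (σ τ : Equiv.Perm (Fin n)) : PM R (σ * τ) = PM R σ * PM R τ := by
  ext i j
  simp only [PM_apply, Matrix.mul_apply]
  simp
  congr

lemma PM_one : PM R (1 : Equiv.Perm (Fin n)) = 1 := by
  ext i j
  simp [PM_apply, Matrix.one_apply]
  congr

lemma PM_swap (a b : Fin n) (h : a ≠ b) :
    PM R (Equiv.swap a b) = 1 - vecMulVec (Pi.single a 1 - Pi.single b 1 : Fin n → R)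
      (Pi.single a 1 - Pi.single b 1) := by
  ext i j
  simp only [PM_apply, Equiv.swap_apply_def, Matrix.sub_apply, Matrix.one_apply, vecMulVec_apply,
    Pi.sub_apply, Pi.single_apply]
  split_ifs <;> simp_all

lemma det_add_vecMulVec [IsDomain R] (B : Matrix (Fin n) (Fin n) R) (hB : B.det ≠ 0)
    (w v : Fin n → R) :
    (B + vecMulVec w v).det = B.det + v ⬝ᵥ (B.adjugate *ᵥ w) := by
  let K := FractionRing R
  let i : R →+* K := algebraMap R K
  have hi : Function.Injective i := IsFractionRing.injective R K
  apply hi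
  have hd : (B.map i).det = i B.det := by
    rw [show B.map i = i.mapMatrix B from rfl, ← RingHom.map_det]
  have hd0 : i B.det ≠ 0 := fun h => hB (hi (by simpa using h))
  have hu : IsUnit (B.map i).det := by
    rw [hd]; exact isUnit_iff_ne_zero.2 hd0
  have := Matrix.det_add_replicateCol_mul_replicateRow (ι := Unit) hu (i ∘ w) (i ∘ v)
  have e : i (B + vecMulVec w v).det =
      (B.map i + replicateCol Unit (i ∘ w) * replicateRow Unit (i ∘ v)).det := by
    rw [RingHom.map_det]
    congr 1
    ext a b
    simp [Matrix.mul_apply, vecMulVec_apply]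
  rw [e, this]
  have ha : (B.map i).adjugate = (B.adjugate).map i := by
    rw [show B.map i = i.mapMatrix B from rfl, ← RingHom.map_adjugate]; rfl
  have h3 : (1 + replicateRow Unit (i ∘ v) * (B.map i)⁻¹ * replicateCol Unit (i ∘ w)).det
      = 1 + (i B.det)⁻¹ * i (v ⬝ᵥ (B.adjugate *ᵥ w)) := by
    rw [Matrix.det_unique, Matrix.inv_def, Ring.inverse_eq_inv, ha, hd, Matrix.mul_smul,
      Matrix.smul_mul, Matrix.add_apply, Matrix.smul_apply, Matrix.mul_assoc]
    simp [Matrix.mul_apply, dotProduct, mulVec, map_sum]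
  rw [h3, hd, map_add, mul_add, mul_one, mul_inv_cancel_left₀ hd0]

lemma deriv_prod {ι : Type*} [DecidableEq ι] (D : Derivation ℤ R R) (s : Finset ι) (f : ι → R) :
    D (∏ i ∈ s, f i) = ∑ i ∈ s, D (f i) * ∏ j ∈ s.erase i, f j := by
  induction s using Finset.induction_on with
  | empty => simp
  | insert a s ha ih =>
    rw [Finset.prod_insert ha, D.leibniz, ih, Finset.sum_insert ha, Finset.erase_insert ha,
      smul_eq_mul, smul_eq_mul, add_comm, Finset.mul_sum, mul_comm (∏ i ∈ s, f i)]
    congr 1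
    refine Finset.sum_congr rfl fun i hi => ?_
    rw [Finset.erase_insert_of_ne (by rintro rfl; exact ha hi),
      Finset.prod_insert (by simp [ha])]
    ring

lemma deriv_det (D : Derivation ℤ R R) (M : Matrix (Fin n) (Fin n) R) :
    D M.det = ∑ i, ∑ j, M.adjugate j i * D (M i j) := by
  have h1 : ∀ i, ∑ j, M.adjugate j i * D (M i j) = (M.updateRow i (fun j => D (M i j))).det := by
    intro i
    rw [← Matrix.cramer_transpose_apply, Matrix.cramer_eq_adjugate_mulVec, ← adjugate_transpose]
    simp [mulVec, dotProduct]
  simp_rw [h1, Matrix.det_apply', map_sum]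
  rw [Finset.sum_comm]
  refine Finset.sum_congr rfl fun σ _ => ?_
  have h0 : D (((Equiv.Perm.sign σ : ℤˣ) : ℤ) : R) = 0 := by
    simpa using D.map_algebraMap ((Equiv.Perm.sign σ : ℤˣ) : ℤ)
  rw [D.leibniz, h0, smul_zero, add_zero, deriv_prod, smul_eq_mul, Finset.mul_sum]
  refine Eq.trans ?_ (Equiv.sum_comp σ _)
  refine Finset.sum_congr rfl fun i _ => ?_
  congr 1
  rw [← Finset.mul_prod_erase Finset.univ _ (Finset.mem_univ i)]
  congr 1
  · simp
  · refine Finset.prod_congr rfl fun j hj => ?_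
    rw [Matrix.updateRow_ne]
    simpa using (Finset.mem_erase.1 hj).1

/-- the homogenized characteristic polynomial -/
noncomputable def Th (y z : R) (σ : Equiv.Perm (Fin n)) : R := (y • (1 : Matrix (Fin n) (Fin n) R) - z • PM R σ).det

lemma Th_entry (y z : R) (σ : Equiv.Perm (Fin n)) (i j : Fin n) :
    (y • (1 : Matrix (Fin n) (Fin n) R) - z • PM R σ) i j =
      (if i = j then y else 0) - (if i = σ j then z else 0) := by
  simp [PM_apply, Matrix.one_apply]

lemma Th_one (y z : R) : Th y z (1 : Equiv.Perm (Fin n)) = (y - z) ^ n := by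
  rw [Th, PM_one, ← sub_smul]
  simp

lemma Th_cycle [IsDomain R] (y z : R) (σ : Equiv.Perm (Fin n)) (hσ : σ.IsCycle) :
    Th y z σ = (y ^ σ.support.card - z ^ σ.support.card) * (y - z) ^ (n - σ.support.card) := by
  classical
  have hcard : (σ.supportᶜ).card = n - σ.support.card := by
    rw [Finset.card_compl, Fintype.card_fin]
  rw [Th, Matrix.det_apply', Finset.sum_eq_add (1 : Equiv.Perm (Fin n)) σ hσ.ne_one.symm]
  · have h1 : ∏ i, (y • (1 : Matrix (Fin n) (Fin n) R) - z • PM R σ) ((1 : Equiv.Perm (Fin n)) i) i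
        = y ^ σ.support.card * (y - z) ^ (n - σ.support.card) := by
      rw [← Finset.prod_mul_prod_compl σ.support, ← hcard]
      congr 1
      · apply Finset.prod_eq_pow_card
        intro i hi
        rw [Th_entry]
        have : i ≠ σ i := fun h => (Equiv.Perm.mem_support.1 hi) h.symm
        simp [this]
      · apply Finset.prod_eq_pow_card
        intro i hi
        rw [Th_entry]
        have : σ i = i := by simpa using hi
        simp [this]
    have h2 : ∏ i, (y • (1 : Matrix (Fin n) (Fin n) R) - z • PM R σ) (σ i) i
        = (-z) ^ σ.support.card * (y - z) ^ (n - σ.support.card) := by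
      rw [← Finset.prod_mul_prod_compl σ.support, ← hcard]
      congr 1
      · apply Finset.prod_eq_pow_card
        intro i hi
        rw [Th_entry]
        simp [Equiv.Perm.mem_support.1 hi]
      · apply Finset.prod_eq_pow_card
        intro i hi
        rw [Th_entry]
        have : σ i = i := by simpa using hi
        simp [this]
    rw [h1, h2, hσ.sign]
    push_cast
    have : ((-1 : R)) ^ σ.support.card * (-z) ^ σ.support.card = z ^ σ.support.card := by
      rw [← mul_pow]; simp
    simp only [Equiv.Perm.sign_one, Units.val_one, Int.cast_one]
    linear_combination (-(y - z) ^ (n - σ.support.card)) * this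
  · intro τ _ hτ
    by_contra hne
    have hprod := right_ne_zero_of_mul hne
    rw [Finset.prod_ne_zero_iff] at hprod
    have hτi : ∀ i, τ i = i ∨ τ i = σ i := by
      intro i
      by_contra hcon
      push Not at hcon
      exact hprod i (Finset.mem_univ i) (by rw [Th_entry]; simp [hcon.1, hcon.2])
    by_cases hex : ∃ i, σ i ≠ i ∧ τ i = σ i
    · obtain ⟨i, hi, hi2⟩ := hex
      apply hτ.2
      have hpow : ∀ k : ℕ, τ ((σ ^ k) i) = σ ((σ ^ k) i) := by
        intro k
        induction k with
        | zero => simpa using hi2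
        | succ k ih =>
          rw [pow_succ', Equiv.Perm.mul_apply]
          rcases hτi (σ ((σ ^ k) i)) with h | h
          · exfalso
            rw [← ih] at h
            have h3 := τ.injective h
            rw [ih] at h3
            have h4 : (σ ^ k) (σ i) = (σ ^ k) i := by
              rw [← Equiv.Perm.mul_apply, ← pow_succ, pow_succ', Equiv.Perm.mul_apply, h3]
            exact hi ((σ ^ k).injective h4)
          · exact h
      ext x
      by_cases hx : σ x = x
      · rcases hτi x with h | h
        · rw [h, hx]
        · rw [h]
      · obtain ⟨k, hk⟩ := hσ.exists_pow_eq hi hx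
        rw [← hk, hpow]
    · apply hτ.1
      push Not at hex
      ext x
      rcases hτi x with h | h
      · simp [h]
      · by_cases hx : σ x = x
        · simp [h, hx]
        · exact absurd h (hex x hx)
  · simp
  · simp

lemma Th_disjoint (y z : R) (σ τ : Equiv.Perm (Fin n)) (h : σ.Disjoint τ) :
    (y - z) ^ n * Th y z (σ * τ) = Th y z σ * Th y z τ := by
  have key : PM R (σ * τ) = PM R σ + PM R τ - 1 := by
    ext i j
    have hh : (σ j = j ∧ (σ * τ) j = τ j) ∨ (τ j = j ∧ (σ * τ) j = σ j) := by
      rcases h j with hj | hj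
      · left
        refine ⟨hj, ?_⟩
        rcases h (τ j) with h' | h'
        · exact h'
        · rw [Equiv.Perm.mul_apply, τ.injective h', hj]
      · right
        exact ⟨hj, by rw [Equiv.Perm.mul_apply, hj]⟩
    simp only [Matrix.add_apply, Matrix.sub_apply, Matrix.one_apply]
    rw [PM_apply, PM_apply, PM_apply]
    rcases hh with ⟨h1, h2⟩ | ⟨h1, h2⟩
    · simp only [h1, h2]; ring
    · simp only [h1, h2]; ring
  have e : (y - z) • (y • (1 : Matrix (Fin n) (Fin n) R) - z • PM R (σ * τ)) =
      (y • (1 : Matrix (Fin n) (Fin n) R) - z • PM R σ) *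
      (y • (1 : Matrix (Fin n) (Fin n) R) - z • PM R τ) := by
    rw [sub_mul, mul_sub, mul_sub]
    simp only [Matrix.smul_mul, Matrix.mul_smul, ← PM_mul, Matrix.one_mul, Matrix.mul_one]
    rw [key]
    simp only [smul_sub, smul_add, sub_smul, smul_smul]
    rw [mul_comm z y]
    module
  rw [Th, Th, Th, ← Matrix.det_mul, ← e, Matrix.det_smul, Fintype.card_fin]

lemma Th_eq [IsDomain R] (y z : R) (hyz : y ≠ z) (σ : Equiv.Perm (Fin n)) :
    Th y z σ = (σ.cycleType.map (fun a => y ^ a - z ^ a)).prod * (y - z) ^ (n - σ.support.card) := by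
  classical
  induction σ using Equiv.Perm.cycle_induction_on with
  | base_one => simp [Th_one]
  | base_cycles σ hσ => rw [Th_cycle y z σ hσ, hσ.cycleType]; simp
  | induction_disjoint σ τ h hc h1 h2 =>
    have h0 : (y - z) ^ n ≠ 0 := pow_ne_zero _ (sub_ne_zero.2 hyz)
    apply mul_left_cancel₀ h0
    rw [Th_disjoint y z σ τ h, h1, h2, h.cycleType_mul, Multiset.map_add, Multiset.prod_add,
      h.card_support_mul]
    have hle := (Equiv.Perm.support (σ * τ)).card_le_univ
    rw [h.card_support_mul, Fintype.card_fin] at hle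
    have : (y - z) ^ (n - σ.support.card) * (y - z) ^ (n - τ.support.card) =
        (y - z) ^ n * (y - z) ^ (n - (σ.support.card + τ.support.card)) := by
      rw [← pow_add, ← pow_add]; congr 1; omega
    linear_combination ((Multiset.map (fun a => y ^ a - z ^ a) σ.cycleType).prod *
      (Multiset.map (fun a => y ^ a - z ^ a) τ.cycleType).prod) * this

lemma Th_rec [IsDomain R] (D : Derivation ℤ R R) (y z : R) (hy : 2 * D y = y) (hz0 : 2 * D z + z = 0)
    (σ : Equiv.Perm (Fin n)) (h0 : Th y z σ ≠ 0) :
    2 * ((y - z) * ∑ t ∈ swapsF n, Th y z (σ * t)) =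
      2 * (n * (y - z) * D (Th y z σ)) - n * (y + z) * Th y z σ := by
  classical
  have hz : 2 * D z = - z := eq_neg_of_add_eq_zero_left hz0
  set B := y • (1 : Matrix (Fin n) (Fin n) R) - z • PM R σ with hB
  have hTh : Th y z σ = B.det := rfl
  set C := B.adjugate * PM R σ with hC
  have hsum : 2 * ∑ t ∈ swapsF n, Th y z (σ * t) =
      ∑ a, ∑ b, ((if a = b then 0 else B.det) + z * (C a a + C b b - C a b - C b a)) := by
    apply two_mul_sum_swapsF
    · intro a b
      simp only [eq_comm (a := a) (b := b)]; ring
    · intro a; simp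
    · intro a b hab
      have e : y • (1 : Matrix (Fin n) (Fin n) R) - z • PM R (σ * Equiv.swap a b) =
          B + vecMulVec (z • (PM R σ *ᵥ (Pi.single a 1 - Pi.single b 1)))
            (Pi.single a 1 - Pi.single b 1) := by
        rw [PM_mul, PM_swap a b hab, Matrix.mul_sub, Matrix.mul_one, Matrix.mul_vecMulVec,
          Matrix.smul_vecMulVec, hB, smul_sub]
        abel
      rw [Th, e, det_add_vecMulVec B (by rw [← hTh]; exact h0), Matrix.mulVec_smul,
        Matrix.mulVec_mulVec, ← hC, if_neg hab]
      congr 1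
      rw [dotProduct_smul, smul_eq_mul, Matrix.mulVec_sub]
      congr 1
      simp [sub_dotProduct, dotProduct_sub]
      ring
  have hCsum : (y - z) * ∑ a, ∑ b, C a b = n * B.det := by
    have hP : PM R σ *ᵥ (fun _ => (1 : R)) = fun _ => 1 := by
      ext i
      simp only [mulVec, dotProduct, PM_apply, mul_one]
      rw [Finset.sum_eq_single (σ.symm i)]
      · simp
      · intro b _ hb
        rw [if_neg]
        rintro rfl
        simp at hb
      · simp
    have hB1 : B *ᵥ (fun _ => (1 : R)) = (y - z) • (fun _ => (1 : R)) := by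
      rw [hB, Matrix.sub_mulVec, Matrix.smul_mulVec, Matrix.smul_mulVec, hP, Matrix.one_mulVec, sub_smul]
    have h1 : B.adjugate *ᵥ (B *ᵥ (fun _ => (1 : R))) = B.det • (fun _ => (1 : R)) := by
      rw [Matrix.mulVec_mulVec, Matrix.adjugate_mul, Matrix.smul_mulVec, Matrix.one_mulVec]
    rw [hB1, Matrix.mulVec_smul] at h1
    have h2 : C *ᵥ (fun _ => (1 : R)) = B.adjugate *ᵥ (fun _ => (1 : R)) := by
      rw [hC, ← Matrix.mulVec_mulVec, hP]
    rw [← h2] at h1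
    have h3 : ∀ a, (y - z) * ∑ b, C a b = B.det := by
      intro a
      have := congrFun h1 a
      simpa [mulVec, dotProduct] using this
    rw [Finset.mul_sum]
    simp [h3]
  have hD : 2 * D B.det = y * B.adjugate.trace + z * C.trace := by
    rw [deriv_det, Finset.mul_sum]
    have e1 : ∀ i, 2 * ∑ j, B.adjugate j i * D (B i j) =
        ∑ j, (y * (B.adjugate j i * (1 : Matrix (Fin n) (Fin n) R) i j)
          + z * (B.adjugate j i * PM R σ i j)) := by
      intro i
      rw [Finset.mul_sum]
      refine Finset.sum_congr rfl fun j _ => ?_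
      have : 2 * D (B i j) = y * (1 : Matrix (Fin n) (Fin n) R) i j + z * PM R σ i j := by
        rw [hB, Th_entry, map_sub, mul_sub, Matrix.one_apply, PM_apply]
        split_ifs <;> simp [hy, hz]
      linear_combination B.adjugate j i * this
    simp_rw [e1, Finset.sum_add_distrib, ← Finset.mul_sum]
    congr 2
    · simp [Matrix.trace, Matrix.one_apply]
    · rw [Finset.sum_comm]
      simp [Matrix.trace, hC, Matrix.mul_apply]
  have htr : y * B.adjugate.trace - z * C.trace = n * B.det := by
    have h1 := congrArg Matrix.trace (Matrix.adjugate_mul B)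
    rw [Matrix.trace_smul, Matrix.trace_one, Fintype.card_fin, smul_eq_mul] at h1
    have h2 : B.adjugate * B = y • B.adjugate - z • C := by
      nth_rw 2 [hB]
      rw [Matrix.mul_sub, Matrix.mul_smul, Matrix.mul_smul, Matrix.mul_one]
    rw [h2, Matrix.trace_sub, Matrix.trace_smul, Matrix.trace_smul, smul_eq_mul, smul_eq_mul] at h1
    rw [h1]; ring
  have hS : ∑ a, ∑ b, ((if a = b then 0 else B.det) + z * (C a a + C b b - C a b - C b a)) =
      (n * n - n) * B.det + z * (2 * n * C.trace - 2 * ∑ a, ∑ b, C a b) := by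
    have e1 : ∀ a b : Fin n, (if a = b then 0 else B.det) = B.det - (if a = b then B.det else 0) := by
      intro a b; split_ifs <;> simp
    have e2 : ∑ a, ∑ b, C b a = ∑ a, ∑ b, C a b := Finset.sum_comm
    simp_rw [e1, Finset.sum_add_distrib, ← Finset.mul_sum, Finset.sum_sub_distrib,
      Finset.sum_add_distrib, e2]
    simp [Matrix.trace]
    rw [← Finset.mul_sum]
    ring
  rw [hTh]
  rw [hS] at hsum
  linear_combination (y - z) * hsum - 2 * z * hCsum - (n:R) * (y - z) * hD - n * (y - z) * htr

end part1

section part2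
open PowerSeries

/-- exp of half -/
noncomputable def ey : ℝ⟦X⟧ := rescale (1/2 : ℝ) (exp ℝ)
/-- exp of minus half -/
noncomputable def ez : ℝ⟦X⟧ := rescale (-(1/2) : ℝ) (exp ℝ)
/-- hyperbolic sine like series -/
noncomputable def hh (a : ℕ) : ℝ⟦X⟧ := ey ^ a - ez ^ a

lemma rescale_exp_pow (c : ℝ) (a : ℕ) : (rescale c (exp ℝ)) ^ a = rescale (a * c) (exp ℝ) := by
  induction a with
  | zero => ext l; simp [PowerSeries.coeff_one]
  | succ a ih =>
    rw [pow_succ, ih, exp_mul_exp_eq_exp_add]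
    congr 2
    push_cast; ring

lemma coeff_hh (a l : ℕ) :
    coeff l (hh a) = (((a:ℝ)/2) ^ l - (-((a:ℝ)/2)) ^ l) / (l.factorial : ℝ) := by
  rw [hh, ey, ez, rescale_exp_pow, rescale_exp_pow, map_sub, coeff_rescale, coeff_rescale, coeff_exp]
  simp
  ring

lemma coeff_hh_even (a i : ℕ) : coeff (2 * i) (hh a) = 0 := by
  rw [coeff_hh]; simp [pow_mul]

lemma coeff_hh_odd (a i : ℕ) :
    coeff (2 * i + 1) (hh a) = a * ((a:ℝ)^2/4) ^ i / ((2 * i + 1).factorial : ℝ) := by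
  rw [coeff_hh]
  congr 1
  rw [Odd.neg_pow (by exact odd_two_mul_add_one i), pow_succ, pow_mul]
  ring

lemma coeff_hh_nonneg (a l : ℕ) : 0 ≤ coeff l (hh a) := by
  rcases Nat.even_or_odd' l with ⟨i, rfl | rfl⟩
  · rw [coeff_hh_even]
  · rw [coeff_hh_odd]; positivity

lemma hh_ne_zero : hh 1 ≠ 0 := by
  intro h
  have := coeff_hh_odd 1 0
  rw [h] at this
  simp at this

lemma hh_one : hh 1 = ey - ez := by simp [hh]

lemma ey_ne_ez : ey ≠ ez := by
  intro h
  apply hh_ne_zero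
  rw [hh_one, h, sub_self]

/-- derivation from an additive map -/
def mkDer {R : Type*} [CommRing R] (d : R →+ R) (h : ∀ a b, d (a * b) = a * d b + b * d a) :
    Derivation ℤ R R := Derivation.mk' d.toIntLinearMap h

/-- derivation -/
noncomputable def DD := mkDer (R := ℝ⟦X⟧) (AddMonoidHom.mk' (fun f => PowerSeries.derivative ℝ f)
  (fun a b => map_add _ a b)) (fun a b => (PowerSeries.derivative ℝ).leibniz a b)

lemma DD_apply (f : ℝ⟦X⟧) (l : ℕ) : coeff l (DD f) = coeff (l+1) f * (l + 1) := by
  rw [← coeff_derivative]; rfl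

lemma DD_ey : 2 * DD ey = ey := by
  ext l
  have : (2 : ℝ⟦X⟧) = C (2:ℝ) := (map_ofNat C 2).symm
  rw [this, coeff_C_mul, DD_apply, ey, coeff_rescale, coeff_rescale, coeff_exp, coeff_exp, Nat.factorial_succ]
  simp
  field_simp
  ring

lemma DD_ez : 2 * DD ez + ez = 0 := by
  ext l
  have : (2 : ℝ⟦X⟧) = C (2:ℝ) := (map_ofNat C 2).symm
  rw [this, map_add, coeff_C_mul, DD_apply, ez, coeff_rescale, coeff_rescale, coeff_exp, coeff_exp, Nat.factorial_succ]
  simp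
  field_simp
  ring

lemma hh_one_dvd (a : ℕ) : hh 1 ∣ hh a := by
  rw [hh_one, hh]; exact sub_dvd_pow_sub_pow _ _ _

lemma exists_hh' (a : ℕ) : ∃ f : ℝ⟦X⟧, hh a = X * f ∧ constantCoeff f = a := by
  have h0 : constantCoeff (hh a) = 0 := by
    have := coeff_hh_even a 0
    simpa using this
  obtain ⟨f, hf⟩ := X_dvd_iff.2 h0
  refine ⟨f, hf, ?_⟩
  have := coeff_hh_odd a 0
  rw [hf, coeff_succ_X_mul] at this
  simpa using this

variable {n : ℕ}

lemma Th_hh (σ : Equiv.Perm (Fin n)) :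
    Th ey ez σ = (σ.partition.parts.map hh).prod := by
  rw [Th_eq _ _ ey_ne_ez, Equiv.Perm.parts_partition, Multiset.map_add, Multiset.prod_add,
    Multiset.map_replicate, Multiset.prod_replicate, Fintype.card_fin, hh_one]
  rfl

lemma hh_ne_zero' {a : ℕ} (ha : 0 < a) : hh a ≠ 0 := by
  intro h
  have := coeff_hh_odd a 0
  rw [h] at this
  simp at this
  exact ha.ne (by exact_mod_cast this)

lemma Th_ne_zero (σ : Equiv.Perm (Fin n)) : Th ey ez σ ≠ 0 := by
  rw [Th_hh]
  rw [Ne, Multiset.prod_eq_zero_iff]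
  simp only [Multiset.mem_map, not_exists, not_and]
  intro a ha
  exact hh_ne_zero' (σ.partition.parts_pos ha)

lemma exists_psi (hn : 1 ≤ n) (σ : Equiv.Perm (Fin n)) : ∃ ψ, Th ey ez σ = hh 1 * ψ := by
  rw [Th_hh]
  have : σ.partition.parts ≠ 0 := by
    intro h
    have := σ.partition.parts_sum
    rw [h] at this
    simp at this
    omega
  obtain ⟨a, ha⟩ := Multiset.exists_mem_of_ne_zero this
  have h1 : hh a ∣ (σ.partition.parts.map hh).prod :=
    Multiset.dvd_prod (Multiset.mem_map_of_mem _ ha)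
  exact (hh_one_dvd a).trans h1

open Classical in
/-- indicator of long cycles -/
noncomputable def chi (σ : Equiv.Perm (Fin n)) : ℝ := if IsConj (finRotate n) σ then 1 else 0

/-- iterated swap sums -/
noncomputable def VV : ℕ → Equiv.Perm (Fin n) → ℝ
  | 0, σ => chi σ
  | M + 1, σ => ∑ t ∈ swapsF n, VV M (σ * t)

lemma isConj_iff_card (hn : 2 ≤ n) (σ : Equiv.Perm (Fin n)) :
    IsConj (finRotate n) σ ↔ σ.partition.parts = {n} := by
  rw [Equiv.Perm.partition_eq_of_isConj, Nat.Partition.ext_iff, Equiv.Perm.parts_partition,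
    cycleType_finRotate_of_le hn, ← Equiv.Perm.sum_cycleType, cycleType_finRotate_of_le hn]
  simp [eq_comm]

lemma psi_zero (hn : 2 ≤ n) (σ : Equiv.Perm (Fin n)) (ψ : ℝ⟦X⟧) (h : Th ey ez σ = hh 1 * ψ) :
    constantCoeff ψ = n * chi σ := by
  rw [Th_hh] at h
  choose f hf1 hf2 using exists_hh'
  have e : ∀ Q : Multiset ℕ, (Q.map hh).prod = X ^ (Multiset.card Q) * (Q.map f).prod := by
    intro Q
    induction Q using Multiset.induction_on with
    | empty => simp
    | cons a Q ih => 
      simp only [Multiset.map_cons, Multiset.prod_cons, Multiset.card_cons, ih, hf1 a]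
      ring
  have hs := σ.partition.parts_sum
  replace hs := hs.trans (Fintype.card_fin n)
  rw [chi]
  simp only [isConj_iff_card hn]
  generalize σ.partition.parts = Q at *
  induction Q using Multiset.induction_on with
  | empty => simp at hs; omega
  | cons a Q _ =>
    rw [e, hf1 1, Multiset.card_cons, pow_succ', mul_assoc, mul_assoc] at h
    have h2 := mul_left_cancel₀ X_ne_zero h
    have h3 := congrArg constantCoeff h2
    simp only [map_mul, map_pow, constantCoeff_X, hf2, Nat.cast_one, one_mul, Multiset.map_cons,
      Multiset.prod_cons] at h3
    rw [← h3]
    by_cases hQ : Q = 0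
    · subst hQ
      simp at hs
      simp [hs]
    · have hc : Multiset.card Q ≠ 0 := by simpa using hQ
      rw [zero_pow hc, zero_mul, if_neg, mul_zero]
      intro h'
      have := congrArg Multiset.card h'
      simp at this
      exact hQ this

lemma psi_rec (ψ : Equiv.Perm (Fin n) → ℝ⟦X⟧) (hψ : ∀ σ, Th ey ez σ = hh 1 * ψ σ)
    (σ : Equiv.Perm (Fin n)) : ∑ t ∈ swapsF n, ψ (σ * t) = n * DD (ψ σ) := by
  have h := Th_rec DD ey ez DD_ey DD_ez σ (Th_ne_zero σ)
  have hL : DD (hh 1 * ψ σ) = hh 1 * DD (ψ σ) + ψ σ * DD (hh 1) := by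
    exact (PowerSeries.derivative ℝ).leibniz (hh 1) (ψ σ)
  simp only [hψ] at h
  rw [← Finset.mul_sum, ← hh_one] at h
  rw [hL] at h
  have hd : 2 * DD (hh 1) = ey + ez := by
    have : DD (hh 1) = DD ey - DD ez := by
      rw [hh_one]; exact map_sub (PowerSeries.derivative ℝ) ey ez
    rw [this]; linear_combination DD_ey - DD_ez
  rw [← hd] at h
  have h2 : (2 : ℝ⟦X⟧) * (hh 1 * hh 1) ≠ 0 :=
    mul_ne_zero (by rw [← map_ofNat (C (R := ℝ)) 2]; simp) (mul_ne_zero hh_ne_zero hh_ne_zero)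
  apply mul_left_cancel₀ h2
  linear_combination h

lemma psi_V (hn : 2 ≤ n) (ψ : Equiv.Perm (Fin n) → ℝ⟦X⟧) (hψ : ∀ σ, Th ey ez σ = hh 1 * ψ σ)
    (M : ℕ) (σ : Equiv.Perm (Fin n)) :
    (n:ℝ) ^ M * M.factorial * coeff M (ψ σ) = n * VV M σ := by
  induction M generalizing σ with
  | zero => simpa [VV] using psi_zero hn σ _ (hψ σ)
  | succ M ih =>
    have h := congrArg (coeff M) (psi_rec ψ hψ σ)
    have e : (n : ℝ⟦X⟧) = C (n:ℝ) := by simp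
    rw [e, coeff_C_mul, DD_apply, map_sum] at h
    rw [VV, Finset.mul_sum]
    simp_rw [← ih, ← Finset.mul_sum, h, Nat.factorial_succ]
    push_cast
    ring

/-- coefficientwise domination of nonnegative series -/
def Maj (f g : ℝ⟦X⟧) : Prop := ∀ l, 0 ≤ coeff l f ∧ coeff l f ≤ coeff l g

lemma Maj.mul {f g f' g' : ℝ⟦X⟧} (h : Maj f g) (h' : Maj f' g') : Maj (f * f') (g * g') := by
  intro l
  rw [coeff_mul, coeff_mul]
  constructor
  · exact Finset.sum_nonneg fun p _ => mul_nonneg (h _).1 (h' _).1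
  · exact Finset.sum_le_sum fun p _ => mul_le_mul (h _).2 (h' _).2 (h' _).1 ((h _).1.trans (h _).2)

lemma Maj.one : Maj 1 1 := by
  intro l; rw [coeff_one]; split_ifs <;> simp

lemma Maj.pow {f g : ℝ⟦X⟧} (h : Maj f g) (k : ℕ) : Maj (f ^ k) (g ^ k) := by
  induction k with
  | zero => simpa using Maj.one
  | succ k ih => rw [pow_succ, pow_succ]; exact ih.mul h

/-- exp of c X squared -/
noncomputable def Em (c : ℝ) : ℝ⟦X⟧ := expand 2 two_ne_zero (rescale c (exp ℝ))

lemma Em_mul (a b : ℝ) : Em a * Em b = Em (a + b) := by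
  rw [Em, Em, Em, ← map_mul, exp_mul_exp_eq_exp_add]

lemma Em_zero : Em 0 = 1 := by
  rw [Em]; simp

lemma coeff_Em_even (c : ℝ) (i : ℕ) : coeff (2 * i) (Em c) = c ^ i / i.factorial := by
  rw [Em, coeff_expand_mul, coeff_rescale, coeff_exp]
  simp; ring

lemma coeff_Em_odd (c : ℝ) (i : ℕ) : coeff (2 * i + 1) (Em c) = 0 := by
  rw [Em, coeff_expand_of_not_dvd]; omega

lemma hh_maj (a : ℕ) : Maj (hh a) (C (a:ℝ) * (X * Em ((a:ℝ)^2))) := by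
  intro l
  refine ⟨coeff_hh_nonneg _ _, ?_⟩
  rw [coeff_C_mul]
  rcases Nat.even_or_odd' l with ⟨i, rfl | rfl⟩
  · rw [coeff_hh_even]
    rcases i with _ | i
    · simp
    · rw [show 2 * (i+1) = (2 * i + 1) + 1 by ring, coeff_succ_X_mul, coeff_Em_odd]; simp
  · rw [coeff_hh_odd, coeff_succ_X_mul, coeff_Em_even, mul_div_assoc]
    apply mul_le_mul_of_nonneg_left _ (by positivity)
    apply div_le_div₀ (by positivity)
    · apply pow_le_pow_left₀ (by positivity)
      nlinarith [sq_nonneg (a:ℝ)]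
    · positivity
    · exact_mod_cast Nat.factorial_le (by omega)

lemma hh_prod_maj (Q : Multiset ℕ) :
    Maj (Q.map hh).prod (C (Q.prod : ℝ) * (X ^ (Multiset.card Q) * Em ((Q.map (fun a => a^2)).sum : ℕ))) := by
  induction Q using Multiset.induction_on with
  | empty => simpa [Em_zero] using Maj.one
  | cons a Q ih =>
    have := (hh_maj a).mul ih
    simp only [Multiset.map_cons, Multiset.prod_cons, Multiset.card_cons, Multiset.sum_cons]
    push_cast at *
    rw [← Em_mul]
    convert this using 1
    rw [map_mul]
    ring

end part2

section part3
open PowerSeries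
variable {n : ℕ}

lemma prod_le_pow_card_nat (Q : Multiset ℕ) (j : ℕ) (h : ∀ a ∈ Q, a ≤ j) :
    Q.prod ≤ j ^ Multiset.card Q := Multiset.prod_le_pow_card Q j h

lemma sum_sq_le (Q : Multiset ℕ) : (Q.map (fun a => a^2)).sum ≤ Q.sum ^ 2 := by
  induction Q using Multiset.induction_on with
  | empty => simp
  | cons a Q ih => simp only [Multiset.map_cons, Multiset.sum_cons]; nlinarith [Nat.zero_le (a * Q.sum)]

lemma even_of_sign {π : Equiv.Perm (Fin n)} {j : ℕ} (hsupp : π.support.card ≤ j)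
    (hsign : Equiv.Perm.sign π = (-1) ^ j) :
    Even (Multiset.card π.cycleType + (j - π.support.card)) := by
  rw [Equiv.Perm.sign_of_cycleType, Equiv.Perm.sum_cycleType] at hsign
  have h2 : ((-1 : ℤˣ)) ^ (π.support.card + Multiset.card π.cycleType + j) = 1 := by
    rw [pow_add, hsign, ← pow_add, Even.neg_one_pow]; exact Even.add_self j
  have h3 : Even (π.support.card + Multiset.card π.cycleType + j) := by
    by_contra h
    rw [Nat.not_even_iff_odd] at h
    rw [h.neg_one_pow] at h2
    exact absurd h2 (by decide)
  rcases h3 with ⟨r, hr⟩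
  exact ⟨r - π.support.card, by omega⟩

lemma coeff_psi_upper (g : ℕ) (hg : 1 ≤ g) (j : ℕ) (hj : 1 ≤ j) (hjn : j < n)
    (π : Equiv.Perm (Fin n)) (hsupp : π.support.card ≤ j) (hsign : Equiv.Perm.sign π = (-1) ^ j)
    (ψ : ℝ⟦X⟧) (hψ : Th ey ez π = hh 1 * ψ) :
    coeff (n - 1 + 2 * g - j) ψ ≤ (j:ℝ)^2 * ((j:ℝ)^2 + n) ^ (g - 1) := by
  set Q := π.cycleType + Multiset.replicate (j - π.support.card) 1 with hQ
  have hQsum : Q.sum = j := by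
    rw [hQ, Multiset.sum_add, Equiv.Perm.sum_cycleType, Multiset.sum_replicate]; simp; omega
  have hQcard : Multiset.card Q = Multiset.card π.cycleType + (j - π.support.card) := by
    simp [hQ]
  obtain ⟨r, hr⟩ := even_of_sign hsupp hsign
  rw [← hQcard] at hr
  have hr1 : 1 ≤ r := by
    rcases Nat.eq_zero_or_pos r with h | h
    · exfalso
      subst h
      have : Q = 0 := by simpa using hr
      rw [this] at hQsum
      simp at hQsum; omega
    · exact h
  -- formula for ψ
  have hψ' : ψ = (Q.map hh).prod * hh 1 ^ (n - j - 1) := by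
    apply mul_left_cancel₀ hh_ne_zero
    rw [← hψ, Th_hh, Equiv.Perm.parts_partition, hQ]
    simp only [Multiset.map_add, Multiset.prod_add, Multiset.map_replicate,
      Multiset.prod_replicate, Fintype.card_fin]
    rw [mul_assoc, mul_left_comm, ← pow_add]
    have : n - π.support.card = (j - π.support.card + (n - j - 1)) + 1 := by omega
    rw [this, pow_succ]
    ring
  set Q' := Q + Multiset.replicate (n - j - 1) 1 with hQ'
  have hψ'' : ψ = (Q'.map hh).prod := by
    rw [hψ', hQ']; simp
  have hmaj := hh_prod_maj Q' (n - 1 + 2 * g - j)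
  rw [← hψ''] at hmaj
  refine hmaj.2.trans ?_
  have hc : Multiset.card Q' = n - j - 1 + (r + r) := by
    rw [hQ', Multiset.card_add, hr, Multiset.card_replicate]; ring
  rw [coeff_C_mul, hc, coeff_X_pow_mul']
  have hprod : (Q'.prod : ℕ) = Q.prod := by rw [hQ']; simp
  have hQj : (Q.prod : ℝ) ≤ ((j:ℝ)^2) ^ r := by
    have : Q.prod ≤ j ^ Multiset.card Q := by
      apply prod_le_pow_card_nat
      intro a ha
      rw [← hQsum]; exact Multiset.le_sum_of_mem ha
    rw [hr] at this
    calc (Q.prod : ℝ) ≤ ((j ^ (r + r) : ℕ) : ℝ) := by exact_mod_cast this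
      _ = _ := by push_cast; rw [← pow_mul]; congr 1; ring
  have hS : (((Q'.map (fun a => a^2)).sum : ℕ) : ℝ) ≤ (j:ℝ)^2 + n := by
    have h1 := sum_sq_le Q
    rw [hQsum] at h1
    have h2 : (Q'.map (fun a => a^2)).sum = (Q.map (fun a => a^2)).sum + (n - j - 1) := by
      rw [hQ']; simp
    have h3 : (Q'.map (fun a => a^2)).sum ≤ j^2 + n := by omega
    exact_mod_cast h3
  have hCpos : (0:ℝ) ≤ (j:ℝ)^2 + n := by positivity
  split_ifs with hle
  · have hrg : r ≤ g := by omega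
    have hidx : n - 1 + 2 * g - j - (n - j - 1 + (r + r)) = 2 * (g - r) := by omega
    rw [hidx, coeff_Em_even, hprod]
    calc (Q.prod : ℝ) * ((((Q'.map (fun a => a^2)).sum : ℕ) : ℝ) ^ (g - r) / ((g-r).factorial : ℝ))
        ≤ ((j:ℝ)^2) ^ r * (((j:ℝ)^2 + n) ^ (g - r) / 1) := by
          gcongr
          exact_mod_cast Nat.factorial_pos _
      _ = (j:ℝ)^2 * (((j:ℝ)^2) ^ (r-1) * ((j:ℝ)^2 + n) ^ (g - r)) := by
          obtain ⟨r', rfl⟩ := Nat.exists_eq_add_of_le' hr1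
          simp [pow_succ]; ring
      _ ≤ (j:ℝ)^2 * (((j:ℝ)^2+n) ^ (r-1) * ((j:ℝ)^2 + n) ^ (g - r)) := by
          gcongr
          linarith [Nat.cast_nonneg (α := ℝ) n]
      _ = _ := by
          rw [← pow_add]; congr 2; omega
  · rw [mul_zero]; positivity

lemma VV_upper (g : ℕ) (hg : 1 ≤ g) (j : ℕ) (hj : 1 ≤ j) (hjn : j < n)
    (π : Equiv.Perm (Fin n)) (hsupp : π.support.card ≤ j) (hsign : Equiv.Perm.sign π = (-1) ^ j) :
    n * VV (n - 1 + 2 * g - j) π ≤ (n:ℝ) ^ (n - 1 + 2 * g - j) * (n - 1 + 2 * g - j).factorial *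
      ((j:ℝ)^2 * ((j:ℝ)^2 + n) ^ (g - 1)) := by
  choose ψ hψ using exists_psi (n := n) (by omega)
  rw [← psi_V (by omega) ψ hψ]
  have := coeff_psi_upper g hg j hj hjn π hsupp hsign (ψ π) (hψ π)
  gcongr

lemma hh_lower : Maj (X * expand 2 two_ne_zero (rescale (1/24 : ℝ) (1 + X))) (hh 1) := by
  intro l
  rcases Nat.even_or_odd' l with ⟨i, rfl | rfl⟩
  · rw [coeff_hh_even]
    rcases i with _ | i
    · simp
    · rw [show 2 * (i+1) = (2 * i + 1) + 1 by ring, coeff_succ_X_mul,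
        coeff_expand_of_not_dvd]
      · simp
      · omega
  · rw [coeff_hh_odd, coeff_succ_X_mul, coeff_expand_mul, coeff_rescale, map_add, coeff_one, coeff_X]
    rcases i with _ | _ | i
    · simp
    · norm_num [Nat.factorial]
    · simp; positivity

lemma coeff_psi_one (hn : 1 ≤ n) (g : ℕ) (ψ : ℝ⟦X⟧) (hψ : Th ey ez (1 : Equiv.Perm (Fin n)) = hh 1 * ψ) :
    ((n-1).choose g : ℝ) * (1/24) ^ g ≤ coeff (n - 1 + 2 * g) ψ := by
  have h1 : ψ = hh 1 ^ (n - 1) := by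
    apply mul_left_cancel₀ hh_ne_zero
    rw [← hψ, Th_one, ← hh_one, ← pow_succ']
    congr 1; omega
  rw [h1]
  refine le_trans (le_of_eq ?_) ((hh_lower.pow (n-1)) (n - 1 + 2 * g)).2
  rw [mul_pow, coeff_X_pow_mul', if_pos (by omega), Nat.add_sub_cancel_left, ← map_pow, ← map_pow,
    coeff_expand_mul, coeff_rescale]
  have : ((1 + X : ℝ⟦X⟧)) ^ (n-1) = (((1 + Polynomial.X : Polynomial ℝ) ^ (n-1) : Polynomial ℝ) : ℝ⟦X⟧) := by
    simp
  rw [this, Polynomial.coeff_coe, Polynomial.coeff_one_add_X_pow]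
  ring

lemma VV_lower (hn : 2 ≤ n) (g : ℕ) :
    (n:ℝ) ^ (n - 1 + 2 * g) * (n - 1 + 2 * g).factorial * (((n-1).choose g : ℝ) * (1/24) ^ g)
      ≤ n * VV (n - 1 + 2 * g) (1 : Equiv.Perm (Fin n)) := by
  choose ψ hψ using exists_psi (n := n) (by omega)
  rw [← psi_V hn ψ hψ]
  have := coeff_psi_one (by omega) g (ψ 1) (hψ 1)
  gcongr

end part3

section part4
variable {n : ℕ}

open Classical in
/-- lists of swaps of given length -/
noncomputable def LL (n : ℕ) : ℕ → Finset (List (Equiv.Perm (Fin n)))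
  | 0 => {[]}
  | N + 1 => (swapsF n ×ˢ LL n N).image (fun p => p.1 :: p.2)

lemma mem_LL (N : ℕ) (F : List (Equiv.Perm (Fin n))) :
    F ∈ LL n N ↔ F.length = N ∧ ∀ t ∈ F, t.IsSwap := by
  induction N generalizing F with
  | zero => simp [LL]; rintro rfl; simp
  | succ N ih =>
    simp only [LL, Finset.mem_image, Finset.mem_product, Prod.exists, ih, mem_swapsF]
    constructor
    · rintro ⟨a, b, ⟨h1, h2, h3⟩, rfl⟩
      simp [h2, h1]; exact h3
    · rintro ⟨h1, h2⟩
      cases F with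
      | nil => simp at h1
      | cons a b =>
        refine ⟨a, b, ⟨h2 a (by simp), by simpa using h1, fun t ht => h2 t (by simp [ht])⟩, rfl⟩

lemma sum_LL_succ (N : ℕ) (f : List (Equiv.Perm (Fin n)) → ℝ) :
    ∑ F ∈ LL n (N+1), f F = ∑ t ∈ swapsF n, ∑ F ∈ LL n N, f (t :: F) := by
  classical
  rw [LL, Finset.sum_image, Finset.sum_product]
  rintro ⟨a, b⟩ _ ⟨c, d⟩ _ h
  simpa using h

lemma sum_swapsF_conj (f : Equiv.Perm (Fin n) → ℝ) (σ L : Equiv.Perm (Fin n)) :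
    ∑ t ∈ swapsF n, f (σ * t * L) = ∑ t ∈ swapsF n, f (σ * L * t) := by
  have hconj : ∀ (t L : Equiv.Perm (Fin n)), t.IsSwap → (L⁻¹ * t * L).IsSwap := by
    rintro _ L ⟨x, y, hxy, rfl⟩
    refine ⟨L⁻¹ x, L⁻¹ y, by simpa using hxy, ?_⟩
    have := Equiv.swap_apply_apply L⁻¹ x y
    rw [this]; simp
  refine Finset.sum_bij' (fun t _ => L⁻¹ * t * L) (fun t _ => L * t * L⁻¹) ?_ ?_ ?_ ?_ ?_
  · intro t ht
    rw [mem_swapsF] at *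
    exact hconj _ _ ht
  · intro t ht
    rw [mem_swapsF] at *
    simpa using hconj _ L⁻¹ ht
  · intro t _; group
  · intro t _; group
  · intro t _; congr 1; group

open Classical in
lemma pattern_sum (N : ℕ) (p : ℕ → Option (Equiv.Perm (Fin n)))
    (hp : ∀ x t, p x = some t → t.IsSwap ∧ x < N) (σ : Equiv.Perm (Fin n)) :
    ((List.range N).filterMap p).length ≤ N ∧
    ∑ F ∈ LL n N, (if (∀ x t, p x = some t → F[x]? = some t) then chi (σ * F.prod) else 0) =
      VV (N - ((List.range N).filterMap p).length) (σ * ((List.range N).filterMap p).prod) := by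
  induction N generalizing p σ with
  | zero =>
    have h0 : ∀ x, p x = none := by
      intro x
      by_contra h
      obtain ⟨t, ht⟩ := Option.ne_none_iff_exists'.1 h
      exact absurd (hp x t ht).2 (by omega)
    simp [LL, VV, h0]
  | succ N ih =>
    have hL : (List.range (N+1)).filterMap p =
        (p 0).toList ++ (List.range N).filterMap (fun x => p (x+1)) := by
      rw [List.range_succ_eq_map, List.filterMap_cons, List.filterMap_map]
      cases h : p 0 <;> simp
    have ih' := fun σ => ih (fun x => p (x+1)) (fun x t h => by
      have := hp _ _ h; exact ⟨this.1, by omega⟩) σ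
    have hlen := (ih' 1).1
    have hmatch : ∀ (f : Equiv.Perm (Fin n)) (F : List (Equiv.Perm (Fin n))),
        (∀ x t, p x = some t → (f :: F)[x]? = some t) ↔
        (∀ t, p 0 = some t → f = t) ∧ (∀ x t, p (x+1) = some t → F[x]? = some t) := by
      intro f F
      constructor
      · intro h
        exact ⟨fun t ht => by simpa using h 0 t ht, fun x t ht => by simpa using h (x+1) t ht⟩
      · rintro ⟨h1, h2⟩ x t ht
        cases x with
        | zero => simpa using h1 t ht
        | succ x => simpa using h2 x t ht
    rw [hL, sum_LL_succ]
    simp only [hmatch, List.prod_cons, ← mul_assoc]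
    cases h0 : p 0 with
    | none =>
      simp only [reduceCtorEq, false_implies, implies_true, true_and, Option.toList_none,
        List.nil_append]
      refine ⟨by omega, ?_⟩
      simp_rw [(ih' _).2]
      rw [sum_swapsF_conj, Nat.succ_sub hlen]
      rfl
    | some s =>
      have hs := (hp 0 s h0).1
      simp only [Option.some.injEq, forall_eq', Option.toList_some, List.singleton_append,
        List.length_cons, List.prod_cons]
      refine ⟨by omega, ?_⟩
      rw [Finset.sum_eq_single s]
      · simp only [true_and]
        rw [(ih' _).2, ← mul_assoc]
        congr 1; omega
      · intro b _ hb
        simp [hb]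
      · intro h; exact absurd ((mem_swapsF s).2 hs) h

open Classical in
lemma pattern_bound (g : ℕ) (hg : 1 ≤ g) (j : ℕ) (hj : 1 ≤ j) (hjn : j < n)
    (e : Fin j → ℕ) (he : Function.Injective e) (heN : ∀ l, e l < n - 1 + 2 * g)
    (w : Fin j → Equiv.Perm (Fin n)) (hw : ∀ l, (w l).IsSwap) (S : Finset (Fin n))
    (hS : S.card ≤ j) (hwS : ∀ l, ∀ x, x ∉ S → w l x = x) :
    n * ∑ F ∈ LL n (n - 1 + 2 * g), (if (∀ l, F[e l]? = some (w l)) then chi F.prod else 0) ≤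
      (n:ℝ) ^ (n - 1 + 2 * g - j) * (n - 1 + 2 * g - j).factorial *
      ((j:ℝ)^2 * ((j:ℝ)^2 + n) ^ (g - 1)) := by
  set N := n - 1 + 2 * g with hN
  let p : ℕ → Option (Equiv.Perm (Fin n)) := fun x =>
    if h : ∃ l, e l = x then some (w h.choose) else none
  have hpe : ∀ l, p (e l) = some (w l) := by
    intro l
    have h : ∃ l', e l' = e l := ⟨l, rfl⟩
    simp only [p, dif_pos h]
    rw [he h.choose_spec]
  have hpn : ∀ x t, p x = some t → ∃ l, e l = x ∧ w l = t := by
    intro x t h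
    by_cases hx : ∃ l, e l = x
    · obtain ⟨l, rfl⟩ := hx
      rw [hpe] at h
      exact ⟨l, rfl, by simpa using h⟩
    · simp [p, dif_neg hx] at h
  have hmatch : ∀ F : List (Equiv.Perm (Fin n)), (∀ l, F[e l]? = some (w l)) ↔
      (∀ x t, p x = some t → F[x]? = some t) := by
    intro F
    constructor
    · intro h x t hx
      obtain ⟨l, rfl, rfl⟩ := hpn x t hx
      exact h l
    · intro h l
      exact h _ _ (hpe l)
  have hps := (pattern_sum N p (fun x t h => by
    obtain ⟨l, rfl, rfl⟩ := hpn x t h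
    exact ⟨hw l, heN l⟩) 1).2
  simp only [one_mul] at hps
  simp only [hmatch]
  set L := (List.range N).filterMap p with hLdef
  have hLmem : ∀ t ∈ L, ∃ l, w l = t := by
    intro t ht
    rw [hLdef, List.mem_filterMap] at ht
    obtain ⟨x, _, hx⟩ := ht
    obtain ⟨l, _, h⟩ := hpn x t hx
    exact ⟨l, h⟩
  have hlen : L.length = j := by
    rw [hLdef, List.length_filterMap_eq_countP]
    have h1 : List.countP (fun a => (p a).isSome) (List.range N) =
        ((Finset.range N).filter (fun a => (p a).isSome)).card := by
      rw [List.countP_eq_length_filter,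
        ← List.toFinset_card_of_nodup (List.nodup_range.filter _)]
      congr 1; ext x; simp
    rw [h1]
    have h2 : (Finset.range N).filter (fun a => (p a).isSome) = Finset.univ.image e := by
      ext x
      simp only [Finset.mem_filter, Finset.mem_range, Finset.mem_image, Finset.mem_univ, true_and]
      constructor
      · rintro ⟨_, h⟩
        obtain ⟨t, ht⟩ := Option.isSome_iff_exists.1 h
        obtain ⟨l, hl, _⟩ := hpn x t ht
        exact ⟨l, hl⟩
      · rintro ⟨l, rfl⟩
        exact ⟨heN l, by rw [hpe]; rfl⟩
    rw [h2, Finset.card_image_of_injective _ he]; simp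
  rw [hps, hlen]
  have hsign : Equiv.Perm.sign L.prod = (-1) ^ j := by
    rw [← hlen]
    apply Equiv.Perm.sign_prod_list_swap
    intro t ht
    obtain ⟨l, rfl⟩ := hLmem t ht
    exact hw l
  have hsupp : L.prod.support ⊆ S := by
    have h1 : ∀ L' : List (Equiv.Perm (Fin n)), (∀ t ∈ L', ∃ l, w l = t) →
        ∀ x, x ∉ S → L'.prod x = x := by
      intro L'
      induction L' with
      | nil => simp
      | cons a L' ih =>
        intro h x hx
        rw [List.prod_cons, Equiv.Perm.mul_apply, ih (fun t ht => h t (by simp [ht])) x hx]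
        obtain ⟨l, rfl⟩ := h a (by simp)
        exact hwS l x hx
    intro x hx
    by_contra hxS
    exact (Equiv.Perm.mem_support.1 hx) (h1 L hLmem x hxS)
  exact VV_upper g hg j hj hjn L.prod ((Finset.card_le_card hsupp).trans hS) hsign

lemma total_sum (N : ℕ) : ∑ F ∈ LL n N, chi F.prod = VV N (1 : Equiv.Perm (Fin n)) := by
  have := (pattern_sum N (fun _ => none) (by simp) (1 : Equiv.Perm (Fin n))).2
  have h2 : List.filterMap (fun _ => (none : Option (Equiv.Perm (Fin n)))) (List.range N) = [] := by
    simp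
  rw [h2] at this
  simpa using this

end part4

section part5
variable {n : ℕ}
open Matrix

open Classical in
/-- root vector of a swap -/
noncomputable def dv (t : Equiv.Perm (Fin n)) : Fin n → ℝ :=
  if h : ∃ p : Fin n × Fin n, p.1 ≠ p.2 ∧ t = Equiv.swap p.1 p.2 then
    Pi.single h.choose.1 1 - Pi.single h.choose.2 1 else 0

lemma dv_spec {t : Equiv.Perm (Fin n)} (ht : t.IsSwap) :
    ∃ a b, a ≠ b ∧ t = Equiv.swap a b ∧ dv t = Pi.single a 1 - Pi.single b 1 := by
  have h : ∃ p : Fin n × Fin n, p.1 ≠ p.2 ∧ t = Equiv.swap p.1 p.2 := by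
    obtain ⟨a, b, h1, h2⟩ := ht
    exact ⟨(a, b), h1, h2⟩
  exact ⟨h.choose.1, h.choose.2, h.choose_spec.1, h.choose_spec.2, by rw [dv, dif_pos h]⟩

lemma dv_refl {t : Equiv.Perm (Fin n)} (ht : t.IsSwap) (x : Fin n → ℝ) :
    x - x ∘ t = (dv t ⬝ᵥ x) • dv t := by
  obtain ⟨a, b, hab, rfl, h⟩ := dv_spec ht
  rw [h, sub_dotProduct]
  ext c
  simp only [single_dotProduct, one_mul, Pi.sub_apply, Function.comp, Pi.smul_apply, smul_eq_mul,
    Pi.single_apply, Equiv.swap_apply_def]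
  split_ifs <;> simp_all

/-- span of the roots -/
noncomputable def WW (u : List (Equiv.Perm (Fin n))) : Submodule ℝ (Fin n → ℝ) :=
  Submodule.span ℝ (dv '' {t | t ∈ u})

lemma WW_mono {u u' : List (Equiv.Perm (Fin n))} (h : ∀ t ∈ u, t ∈ u') : WW u ≤ WW u' :=
  Submodule.span_mono (Set.image_mono h)

lemma dv_mem_WW {u : List (Equiv.Perm (Fin n))} {t} (h : t ∈ u) : dv t ∈ WW u :=
  Submodule.subset_span ⟨t, h, rfl⟩

lemma sub_mem_WW (u : List (Equiv.Perm (Fin n))) (hu : ∀ t ∈ u, t.IsSwap) (x : Fin n → ℝ) :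
    x - x ∘ u.prod ∈ WW u := by
  induction u generalizing x with
  | nil => simp
  | cons t u ih =>
    have h1 := ih (fun s hs => hu s (by simp [hs])) (x ∘ t)
    have h2 : x - x ∘ t ∈ WW (t :: u) := by
      rw [dv_refl (hu t (by simp))]
      exact Submodule.smul_mem _ _ (dv_mem_WW (by simp))
    have h3 := Submodule.add_mem _ h2 (WW_mono (u' := t :: u) (fun s hs => by simp [hs]) h1)
    simpa [Function.comp_def] using h3

lemma fix_of_orth (u : List (Equiv.Perm (Fin n))) (hu : ∀ t ∈ u, t.IsSwap) (x : Fin n → ℝ)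
    (hx : ∀ t ∈ u, dv t ⬝ᵥ x = 0) : x ∘ u.prod = x := by
  induction u with
  | nil => simp
  | cons t u ih =>
    have h1 := ih (fun s hs => hu s (by simp [hs])) (fun s hs => hx s (by simp [hs]))
    have h2 := dv_refl (hu t (by simp)) x
    rw [hx t (by simp), zero_smul, sub_eq_zero] at h2
    rw [List.prod_cons, Equiv.Perm.coe_mul, ← Function.comp_assoc, ← h2, h1]

/-- successive independence -/
def Ind : List (Equiv.Perm (Fin n)) → Prop
  | [] => True
  | t :: u => dv t ∉ WW u ∧ Ind u

lemma orth_of_fix (u : List (Equiv.Perm (Fin n))) (hu : ∀ t ∈ u, t.IsSwap) (hi : Ind u)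
    (x : Fin n → ℝ) (hx : x ∘ u.prod = x) : ∀ t ∈ u, dv t ⬝ᵥ x = 0 := by
  induction u with
  | nil => simp
  | cons t u ih =>
    have h1 := sub_mem_WW u (fun s hs => hu s (by simp [hs])) (x ∘ t)
    have h2 := dv_refl (hu t (by simp)) x
    rw [List.prod_cons, Equiv.Perm.coe_mul, ← Function.comp_assoc] at hx
    rw [hx] at h1
    have h3 : (dv t ⬝ᵥ x) • dv t ∈ WW u := by
      rw [← h2, ← neg_sub]; exact Submodule.neg_mem _ h1
    have h4 : dv t ⬝ᵥ x = 0 := by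
      by_contra hne
      exact hi.1 ((Submodule.smul_mem_iff _ hne).1 h3)
    rw [h4, zero_smul, sub_eq_zero] at h2
    rw [← h2] at hx
    intro s hs
    rcases List.mem_cons.1 hs with rfl | hs
    · exact h4
    · exact ih (fun s hs => hu s (by simp [hs])) hi.2 hx s hs

lemma WW_le (u u' : List (Equiv.Perm (Fin n))) (hu : ∀ t ∈ u, t.IsSwap) (hu' : ∀ t ∈ u', t.IsSwap)
    (hi : Ind u) (h : u.prod = u'.prod) : WW u ≤ WW u' := by
  rw [WW, Submodule.span_le]
  rintro _ ⟨t, ht, rfl⟩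
  let E := dotProductEquiv ℝ (Fin n)
  let Lf : {t // t ∈ u'} → Module.Dual ℝ (Fin n → ℝ) := fun s => E (dv s.1)
  have key : E (dv t) ∈ Submodule.span ℝ (Set.range Lf) := by
    apply mem_span_of_iInf_ker_le_ker
    intro x hx
    simp only [Submodule.mem_iInf, LinearMap.mem_ker] at hx ⊢
    have h1 : x ∘ u'.prod = x := fix_of_orth u' hu' x (fun s hs => hx ⟨s, hs⟩)
    rw [← h] at h1
    exact orth_of_fix u hu hi x h1 t ht
  have h2 : Set.range Lf = E.toLinearMap '' (dv '' {t | t ∈ u'}) := by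
    ext y
    simp [Lf]
  rw [h2, ← Submodule.map_span] at key
  obtain ⟨y, hy, hye⟩ := key
  have := E.injective hye
  rw [← this]; exact hy

lemma length_le_finrank (u : List (Equiv.Perm (Fin n))) (hi : Ind u) :
    u.length ≤ Module.finrank ℝ (WW u) := by
  induction u with
  | nil => simp
  | cons t u ih =>
    have h1 := ih hi.2
    have h2 : WW u < WW (t :: u) := by
      apply lt_of_le_of_ne (WW_mono (fun s hs => by simp [hs]))
      intro h
      apply hi.1
      rw [h]
      exact dv_mem_WW (by simp)
    have := Submodule.finrank_lt_finrank_of_lt h2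
    simp only [List.length_cons]
    omega

lemma finrank_le_length (u : List (Equiv.Perm (Fin n))) :
    Module.finrank ℝ (WW u) ≤ u.length := by
  classical
  have : WW u = Submodule.span ℝ (((u.map dv).toFinset : Finset (Fin n → ℝ)) : Set (Fin n → ℝ)) := by
    rw [WW]; congr 1; ext y; simp
  rw [this]
  refine (finrank_span_finset_le_card _).trans ?_
  refine (List.toFinset_card_le _).trans ?_
  simp

lemma not_Ind (u u' : List (Equiv.Perm (Fin n))) (hu : ∀ t ∈ u, t.IsSwap)
    (hu' : ∀ t ∈ u', t.IsSwap) (h : u.prod = u'.prod) (hl : u'.length < u.length) : ¬ Ind u := by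
  intro hi
  have h1 := Submodule.finrank_mono (WW_le u u' hu hu' hi h)
  have h2 := length_le_finrank u hi
  have h3 := finrank_le_length u'
  omega

lemma exists_of_not_Ind (u : List (Equiv.Perm (Fin n))) (hi : ¬ Ind u) :
    ∃ u1 t u2, u = u1 ++ t :: u2 ∧ dv t ∈ WW u2 := by
  induction u with
  | nil => exact absurd trivial hi
  | cons t u ih =>
    by_cases h : dv t ∈ WW u
    · exact ⟨[], t, u, rfl, h⟩
    · have : ¬ Ind u := fun h' => hi ⟨h, h'⟩
      obtain ⟨u1, s, u2, rfl, h2⟩ := ih this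
      exact ⟨t :: u1, s, u2, rfl, h2⟩

/-- graph of a list of swaps -/
def GG (u : List (Equiv.Perm (Fin n))) : SimpleGraph (Fin n) where
  Adj a b := a ≠ b ∧ Equiv.swap a b ∈ u
  symm := ⟨fun a b h => ⟨h.1.symm, by rw [Equiv.swap_comm]; exact h.2⟩⟩
  loopless := ⟨fun a h => h.1 rfl⟩

lemma reachable_of_mem (u : List (Equiv.Perm (Fin n))) (hu : ∀ t ∈ u, t.IsSwap) (a b : Fin n)
    (h : (Pi.single a 1 - Pi.single b 1 : Fin n → ℝ) ∈ WW u) : (GG u).Reachable a b := by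
  classical
  by_contra hr
  let φ : Fin n → ℝ := fun y => if (GG u).Reachable a y then 1 else 0
  have h1 : ∀ y ∈ WW u, y ⬝ᵥ φ = 0 := by
    intro y hy
    induction hy using Submodule.span_induction with
    | mem y hy =>
      obtain ⟨t, ht, rfl⟩ := hy
      obtain ⟨c, d, hcd, rfl, hd⟩ := dv_spec (hu t ht)
      rw [hd, sub_dotProduct, single_dotProduct, single_dotProduct]
      have hadj : (GG u).Adj c d := ⟨hcd, ht⟩
      have : (GG u).Reachable a c ↔ (GG u).Reachable a d :=
        ⟨fun h => h.trans hadj.reachable, fun h => h.trans hadj.symm.reachable⟩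
      simp [φ, this]
    | zero => simp
    | add x y _ _ hx hy => rw [add_dotProduct, hx, hy, add_zero]
    | smul c x _ hx => rw [smul_dotProduct, hx, smul_zero]
  have h2 := h1 _ h
  rw [sub_dotProduct, single_dotProduct, single_dotProduct] at h2
  simp [φ, hr] at h2

lemma swap_eq_cases {a b c d : Fin n} (hab : a ≠ b) (h : Equiv.swap a b = Equiv.swap c d) :
    (a = c ∧ b = d) ∨ (a = d ∧ b = c) := by
  have e1 : Equiv.swap c d a = b := by rw [← h]; simp
  have e2 : Equiv.swap c d b = a := by rw [← h]; simp
  rw [Equiv.swap_apply_def] at e1 e2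
  split_ifs at e1 e2 <;> (try subst_vars) <;> grind

lemma trail (u u' : List (Equiv.Perm (Fin n))) (hu : ∀ t ∈ u, t.IsSwap)
    (hu' : ∀ t ∈ u', t.IsSwap) (h : u.prod = u'.prod) (hl : u'.length < u.length) :
    ∃ u1 t u2, u = u1 ++ t :: u2 ∧ ∃ i, 1 ≤ i ∧ ∃ (v : ℕ → Fin n) (e : Fin i → ℕ),
      Function.Injective e ∧ (∀ l : Fin i, u2[e l]? = some (Equiv.swap (v l) (v (l+1)))) ∧
      t = Equiv.swap (v 0) (v i) := by
  obtain ⟨u1, t, u2, rfl, ht⟩ := exists_of_not_Ind u (not_Ind u u' hu hu' h hl)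
  obtain ⟨a, b, hab, rfl, hd⟩ := dv_spec (hu t (by simp))
  rw [hd] at ht
  have hr := reachable_of_mem u2 (fun s hs => hu s (by simp [hs])) a b ht
  obtain ⟨p, hp⟩ := hr.exists_isPath
  refine ⟨u1, _, u2, rfl, p.length, ?_, p.getVert, ?_⟩
  · by_contra hlt
    have : p.length = 0 := by omega
    exact hab (SimpleGraph.Walk.eq_of_length_eq_zero this)
  · have hadj : ∀ l : Fin p.length, (GG u2).Adj (p.getVert l) (p.getVert (l+1)) :=
      fun l => p.adj_getVert_succ l.2
    have hex : ∀ l : Fin p.length, ∃ x : ℕ, u2[x]? = some (Equiv.swap (p.getVert l) (p.getVert (l+1))) :=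
      fun l => List.mem_iff_getElem?.1 (hadj l).2
    choose e he using hex
    refine ⟨e, ?_, he, by simp⟩
    intro l l' hll
    have h1 := he l
    rw [hll, he l', Option.some.injEq] at h1
    have hinj := hp.getVert_injOn
    rcases swap_eq_cases (hadj l').1 h1 with ⟨h2, h3⟩ | ⟨h2, h3⟩
    · have := hinj (by simp) (by simp) h2
      ext; exact this.symm
    · have h4 := hinj (by simp) (by simp) h2
      have h5 := hinj (by simp) (by simp) h3
      omega

end part5

section part6
variable {n : ℕ}

/-- existence of a closed trail in a prefix -/
def BadT (m : ℕ) (F : List (Equiv.Perm (Fin n))) : Prop :=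
  ∃ s, s < m ∧ ∃ i, ∃ (v : ℕ → Fin n) (e : Fin i → ℕ), Function.Injective e ∧
    (∀ l, e l < s) ∧ (∀ l : Fin i, F[e l]? = some (Equiv.swap (v l) (v (l+1)))) ∧
    F[s]? = some (Equiv.swap (v 0) (v i))

lemma prod_eq_of_reverse (u u' : List (Equiv.Perm (Fin n))) (hu : ∀ t ∈ u, t.IsSwap)
    (hu' : ∀ t ∈ u', t.IsSwap) (h : u.reverse.prod = u'.reverse.prod) : u.prod = u'.prod := by
  have key : ∀ u : List (Equiv.Perm (Fin n)), (∀ t ∈ u, t.IsSwap) → u.prod⁻¹ = u.reverse.prod := by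
    intro u hu
    rw [List.prod_inv_reverse]
    congr 2
    conv_rhs => rw [← List.map_id u]
    apply List.map_congr_left
    intro t ht
    obtain ⟨a, b, _, rfl⟩ := hu t ht
    simp
  rw [← inv_inj, key u hu, key u' hu', h]

lemma bad_of_genus (g k : ℕ) (l : List (Equiv.Perm (Fin n))) (hl : l ∈ Fcal n g)
    (hk : k ≤ n - 1 + 2 * g) (hgen : genus n (l.take k) ≠ g) :
    BadT (n - 1 + 2 * g - k) l.reverse := by
  have hmem : g ∈ {g | ∃ l', l.take k <+: l' ∧ l' ∈ Fcal n g} := ⟨l, List.take_prefix k l, hl⟩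
  have hle : genus n (l.take k) ≤ g := Nat.sInf_le hmem
  have hlt : genus n (l.take k) < g := lt_of_le_of_ne hle hgen
  obtain ⟨l', ⟨w', rfl⟩, hl'⟩ := Nat.sInf_mem ⟨g, hmem⟩
  change _ ∈ Fcal n (genus n (l.take k)) at hl'
  obtain ⟨h1, h2, h3⟩ := hl
  obtain ⟨h1', h2', h3'⟩ := hl'
  have hlk : (l.take k).length = k := by rw [List.length_take]; omega
  have hprod : (l.drop k).prod = w'.prod := by
    apply prod_eq_of_reverse
    · intro t ht; exact h2 t (List.mem_of_mem_drop ht)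
    · intro t ht; exact h2' t (by simp [ht])
    · rw [← h3] at h3'
      have hl2 : prodLR l = prodLR (l.take k ++ l.drop k) := by rw [List.take_append_drop]
      rw [hl2] at h3'
      unfold prodLR at h3'
      rw [List.reverse_append, List.reverse_append, List.prod_append, List.prod_append] at h3'
      exact (mul_right_cancel h3').symm
  rw [List.length_append, hlk] at h1'
  obtain ⟨u1, t, u2, hu, i, hi, v, e, he, he2, ht⟩ := trail (l.drop k) w'
    (fun t ht => h2 t (List.mem_of_mem_drop ht)) (fun t ht => h2' t (by simp [ht])) hprod
    (by rw [List.length_drop]; omega)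
  have hlu : l.reverse = u2.reverse ++ t :: (l.take k ++ u1).reverse := by
    conv_lhs => rw [← List.take_append_drop k l, hu]
    simp
  have hlen : u2.length < n - 1 + 2 * g - k := by
    have := congrArg List.length hu
    rw [List.length_drop] at this
    simp at this
    omega
  have helt : ∀ l, e l < u2.length := by
    intro l
    by_contra h
    have := he2 l
    rw [List.getElem?_eq_none (by omega)] at this
    simp at this
  refine ⟨u2.length, hlen, i, v, fun l => u2.length - 1 - e l, ?_, ?_, ?_, ?_⟩
  · intro l l' h
    have := helt l
    have := helt l'
    apply he
    simp only at h
    omega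
  · intro l
    have := helt l
    simp only; omega
  · intro x
    have := helt x
    beta_reduce
    rw [hlu, List.getElem?_append_left (by simp; omega), List.getElem?_reverse (by omega), ← he2]
    congr 1; omega
  · rw [hlu, List.getElem?_append_right (by simp)]
    simp [ht]

open Classical in
/-- the weight bound -/
noncomputable def Bw (n g j : ℕ) : ℝ := (n:ℝ) ^ (n - 1 + 2 * g - j) * (n - 1 + 2 * g - j).factorial *
      ((j:ℝ)^2 * ((j:ℝ)^2 + n) ^ (g - 1))

lemma chi_nonneg (σ : Equiv.Perm (Fin n)) : 0 ≤ chi σ := by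
  rw [chi]; split_ifs <;> simp

/-- the set of data of a trail match -/
def MatchT (F : List (Equiv.Perm (Fin n))) (s i : ℕ) (e : Fin i → Fin s) (v : Fin (i+1) → Fin n) : Prop :=
    (∀ l : Fin i, F[(e l : ℕ)]? = some (Equiv.swap (v l.castSucc) (v l.succ))) ∧
    F[s]? = some (Equiv.swap (v 0) (v (Fin.last i)))

open Classical in
lemma single_bound (g : ℕ) (hg : 1 ≤ g) (s i : ℕ) (hi : i + 1 < n) (hs : s < n - 1 + 2 * g)
    (e : Fin i → Fin s) (he : Function.Injective e) (v : Fin (i+1) → Fin n) :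
    n * ∑ F ∈ LL n (n - 1 + 2 * g), (if MatchT F s i e v then chi F.prod else 0) ≤ Bw n g (i+1) := by
  let w : Fin (i+1) → Equiv.Perm (Fin n) :=
    Fin.snoc (α := fun _ => Equiv.Perm (Fin n)) (fun l : Fin i => Equiv.swap (v l.castSucc) (v l.succ)) (Equiv.swap (v 0) (v (Fin.last i)))
  let e' : Fin (i+1) → ℕ := Fin.snoc (α := fun _ => ℕ) (fun l : Fin i => (e l : ℕ)) s
  have hM : ∀ F : List (Equiv.Perm (Fin n)), MatchT F s i e v ↔ ∀ l, F[e' l]? = some (w l) := by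
    intro F
    rw [MatchT, Fin.forall_fin_succ']
    simp [w, e']
  simp only [hM]
  by_cases hw : ∀ l, (w l).IsSwap
  · apply pattern_bound g hg (i+1) (by omega) hi e' ?_ ?_ w hw (Finset.univ.image v) ?_ ?_
    · intro a b hab
      induction a using Fin.lastCases with
      | last =>
        induction b using Fin.lastCases with
        | last => rfl
        | cast b => simp [e'] at hab; omega
      | cast a =>
        induction b using Fin.lastCases with
        | last => simp [e'] at hab; omega
        | cast b =>
          simp [e'] at hab
          rw [he (Fin.ext hab)]
    · intro l
      induction l using Fin.lastCases with
      | last => simpa [e'] using hs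
      | cast l => simp [e']; omega
    · refine Finset.card_image_le.trans ?_
      simp
    · intro l x hx
      have hx' : ∀ a, x ≠ v a := by
        intro a h; apply hx; rw [h]; exact Finset.mem_image_of_mem _ (Finset.mem_univ _)
      induction l using Fin.lastCases with
      | last => simp only [w, Fin.snoc_last]; exact Equiv.swap_apply_of_ne_of_ne (hx' _) (hx' _)
      | cast l => simp only [w, Fin.snoc_castSucc]; exact Equiv.swap_apply_of_ne_of_ne (hx' _) (hx' _)
  · push Not at hw
    obtain ⟨l, hl⟩ := hw
    rw [Finset.sum_eq_zero, mul_zero]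
    · rw [Bw]; positivity
    · intro F hF
      rw [if_neg]
      intro h
      have := List.mem_of_getElem? (h l)
      exact hl (((mem_LL _ _).1 hF).2 _ this)

open Classical in
lemma union_bound (g : ℕ) (hg : 1 ≤ g) (m : ℕ) (hmn : m < n) :
    n * ∑ F ∈ LL n (n - 1 + 2 * g), (if BadT m F then chi F.prod else 0) ≤
      ∑ s ∈ Finset.range m, ∑ i ∈ Finset.range m, (s.descFactorial i : ℝ) * (n:ℝ) ^ (i+1) * Bw n g (i+1) := by
  have h1 : ∀ F : List (Equiv.Perm (Fin n)), (if BadT m F then chi F.prod else 0) ≤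
      ∑ s ∈ Finset.range m, ∑ i ∈ Finset.range m, ∑ e : Fin i ↪ Fin s, ∑ v : Fin (i+1) → Fin n,
        if MatchT F s i e v then chi F.prod else 0 := by
    intro F
    have hnn : ∀ p : Prop, 0 ≤ (if p then chi F.prod else 0) := by
      intro p; split_ifs
      · exact chi_nonneg _
      · exact le_rfl
    split_ifs with hb
    · obtain ⟨s, hs, i, v, e, he, hes, hm1, hm2⟩ := hb
      let e' : Fin i ↪ Fin s := ⟨fun l => ⟨e l, hes l⟩, fun a b h => he (by simpa using h)⟩
      have his : i ≤ s := by simpa using Fintype.card_le_of_embedding e'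
      let v' : Fin (i+1) → Fin n := fun a => v a
      have hmt : MatchT F s i e' v' := by
        refine ⟨fun l => ?_, ?_⟩
        · exact hm1 l
        · simpa [v'] using hm2
      calc chi F.prod = if MatchT F s i e' v' then chi F.prod else 0 := by rw [if_pos hmt]
        _ ≤ ∑ v : Fin (i+1) → Fin n, if MatchT F s i e' v then chi F.prod else 0 :=
          Finset.single_le_sum (f := fun v : Fin (i+1) → Fin n => if MatchT F s i e' v then chi F.prod else 0)
            (fun v _ => hnn _) (Finset.mem_univ v')
        _ ≤ ∑ e : Fin i ↪ Fin s, ∑ v : Fin (i+1) → Fin n, if MatchT F s i e v then chi F.prod else 0 :=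
          Finset.single_le_sum (f := fun e : Fin i ↪ Fin s => ∑ v : Fin (i+1) → Fin n, if MatchT F s i e v then chi F.prod else 0)
            (fun e _ => Finset.sum_nonneg fun v _ => hnn _) (Finset.mem_univ e')
        _ ≤ ∑ i ∈ Finset.range m, ∑ e : Fin i ↪ Fin s, ∑ v : Fin (i+1) → Fin n, if MatchT F s i e v then chi F.prod else 0 :=
          Finset.single_le_sum (f := fun i => ∑ e : Fin i ↪ Fin s, ∑ v : Fin (i+1) → Fin n, if MatchT F s i e v then chi F.prod else 0)
            (fun i _ => Finset.sum_nonneg fun e _ => Finset.sum_nonneg fun v _ => hnn _) (Finset.mem_range.2 (by omega))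
        _ ≤ _ :=
          Finset.single_le_sum (f := fun s => ∑ i ∈ Finset.range m, ∑ e : Fin i ↪ Fin s, ∑ v : Fin (i+1) → Fin n, if MatchT F s i e v then chi F.prod else 0)
            (fun s _ => Finset.sum_nonneg fun i _ => Finset.sum_nonneg fun e _ => Finset.sum_nonneg fun v _ => hnn _) (Finset.mem_range.2 hs)
    · exact Finset.sum_nonneg fun s _ => Finset.sum_nonneg fun i _ => Finset.sum_nonneg fun e _ =>
        Finset.sum_nonneg fun v _ => hnn _
  calc n * ∑ F ∈ LL n (n - 1 + 2 * g), (if BadT m F then chi F.prod else 0)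
      ≤ n * ∑ F ∈ LL n (n - 1 + 2 * g), ∑ s ∈ Finset.range m, ∑ i ∈ Finset.range m,
        ∑ e : Fin i ↪ Fin s, ∑ v : Fin (i+1) → Fin n,
        (if MatchT F s i e v then chi F.prod else 0) := by
        gcongr with F _
        exact h1 F
    _ = ∑ s ∈ Finset.range m, ∑ i ∈ Finset.range m, ∑ e : Fin i ↪ Fin s, ∑ v : Fin (i+1) → Fin n,
        n * ∑ F ∈ LL n (n - 1 + 2 * g), (if MatchT F s i e v then chi F.prod else 0) := by
        rw [Finset.sum_comm, Finset.mul_sum]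
        refine Finset.sum_congr rfl fun s _ => ?_
        rw [Finset.sum_comm, Finset.mul_sum]
        refine Finset.sum_congr rfl fun i _ => ?_
        rw [Finset.sum_comm, Finset.mul_sum]
        refine Finset.sum_congr rfl fun e _ => ?_
        rw [Finset.sum_comm, Finset.mul_sum]
    _ ≤ ∑ s ∈ Finset.range m, ∑ i ∈ Finset.range m, ∑ e : Fin i ↪ Fin s, ∑ v : Fin (i+1) → Fin n,
        Bw n g (i+1) := by
        refine Finset.sum_le_sum fun s hs => Finset.sum_le_sum fun i hi => Finset.sum_le_sum fun e _ =>
          Finset.sum_le_sum fun v _ => ?_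
        rw [Finset.mem_range] at hs hi
        exact single_bound g hg s i (by omega) (by omega) e e.injective v
    _ = _ := by
        refine Finset.sum_congr rfl fun s _ => Finset.sum_congr rfl fun i _ => ?_
        simp [Fintype.card_embedding_eq]
        ring

end part6

section part7
variable {n : ℕ}

lemma sum_descFactorial (m i : ℕ) :
    (∑ s ∈ Finset.range m, s.descFactorial i) * (i+1) = m.descFactorial (i+1) := by
  induction m with
  | zero => simp
  | succ m ih =>
    rw [Finset.sum_range_succ, add_mul, ih, Nat.succ_descFactorial_succ, Nat.descFactorial_succ]
    by_cases h : i ≤ m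
    · rw [mul_comm (m.descFactorial i), ← add_mul]
      congr 1; omega
    · rw [Nat.descFactorial_eq_zero_iff_lt.2 (by omega)]; simp

lemma descFactorial_ratio (m N j : ℕ) (h : m ≤ N) :
    m.descFactorial j * N ^ j ≤ N.descFactorial j * m ^ j := by
  induction j with
  | zero => simp
  | succ j ih =>
    rw [Nat.descFactorial_succ, Nat.descFactorial_succ]
    have h1 : (m - j) * N ≤ (N - j) * m := by
      rw [Nat.sub_mul, Nat.sub_mul]
      have : j * m ≤ j * N := Nat.mul_le_mul_left _ h
      have : m * N = N * m := mul_comm _ _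
      omega
    calc (m - j) * m.descFactorial j * N ^ (j+1) = ((m - j) * N) * (m.descFactorial j * N ^ j) := by ring
      _ ≤ ((N - j) * m) * (N.descFactorial j * m ^ j) := Nat.mul_le_mul h1 ih
      _ = _ := by ring

lemma term_bound (g m i : ℕ) (him : i < m) (hm : m ≤ n - 1 + 2 * g) :
    (∑ s ∈ Finset.range m, (s.descFactorial i : ℝ)) * (n:ℝ) ^ (i+1) * Bw n g (i+1) ≤
      (n:ℝ) ^ (n - 1 + 2 * g) * (n - 1 + 2 * g).factorial *
      (((m:ℝ) / (n - 1 + 2 * g : ℕ)) ^ (i+1) * ((i+1 : ℕ) : ℝ) * ((((i+1 : ℕ):ℝ))^2 + n) ^ (g - 1)) := by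
  rw [Bw]
  set N := n - 1 + 2 * g with hN
  have hN0 : (0:ℝ) < N := by exact_mod_cast (by omega : 0 < N)
  have h1 : (∑ s ∈ Finset.range m, (s.descFactorial i : ℝ)) * ((i+1 : ℕ) : ℝ) = (m.descFactorial (i+1) : ℝ) := by
    exact_mod_cast sum_descFactorial m i
  have h2 : (m.descFactorial (i+1) : ℝ) * (N - (i+1)).factorial ≤ ((m:ℝ) / N) ^ (i+1) * N.factorial := by
    have h3 : (m.descFactorial (i+1) : ℝ) * (N:ℝ) ^ (i+1) ≤ (N.descFactorial (i+1) : ℝ) * (m:ℝ) ^ (i+1) := by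
      exact_mod_cast descFactorial_ratio m N (i+1) hm
    have h4 : ((N - (i+1)).factorial : ℝ) * N.descFactorial (i+1) = N.factorial := by
      exact_mod_cast Nat.factorial_mul_descFactorial (by omega : i + 1 ≤ N)
    rw [div_pow, div_mul_eq_mul_div, le_div_iff₀ (by positivity), ← h4]
    calc _ = ((m.descFactorial (i+1) : ℝ) * (N:ℝ) ^ (i+1)) * (N - (i+1)).factorial := by ring
      _ ≤ ((N.descFactorial (i+1) : ℝ) * (m:ℝ) ^ (i+1)) * (N - (i+1)).factorial := by gcongr
      _ = _ := by ring
  have h5 : (n:ℝ) ^ (i+1) * (n:ℝ) ^ (N - (i+1)) = (n:ℝ) ^ N := by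
    rw [← pow_add]; congr 1; omega
  calc _ = ((n:ℝ) ^ (i+1) * (n:ℝ) ^ (N - (i+1))) *
        (((∑ s ∈ Finset.range m, (s.descFactorial i : ℝ)) * ((i+1 : ℕ) : ℝ)) * (N - (i+1)).factorial) *
        (((i+1 : ℕ) : ℝ) * ((((i+1 : ℕ):ℝ))^2 + n) ^ (g - 1)) := by ring
    _ = (n:ℝ) ^ N * ((m.descFactorial (i+1) : ℝ) * (N - (i+1)).factorial) *
        (((i+1 : ℕ) : ℝ) * ((((i+1 : ℕ):ℝ))^2 + n) ^ (g - 1)) := by rw [h5, h1]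
    _ ≤ (n:ℝ) ^ N * (((m:ℝ) / N) ^ (i+1) * N.factorial) *
        (((i+1 : ℕ) : ℝ) * ((((i+1 : ℕ):ℝ))^2 + n) ^ (g - 1)) := by gcongr
    _ = _ := by ring

/-- the series in the final bound -/
noncomputable def SS (n g m : ℕ) : ℝ := ∑ i ∈ Finset.range m,
  (((m:ℝ) / (n - 1 + 2 * g : ℕ)) ^ (i+1) * ((i+1 : ℕ) : ℝ) * ((((i+1 : ℕ):ℝ))^2 + n) ^ (g - 1))

open Classical in
lemma bad_bound (g : ℕ) (hg : 1 ≤ g) (m : ℕ) (hmn : m < n) :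
    n * ∑ F ∈ LL n (n - 1 + 2 * g), (if BadT m F then chi F.prod else 0) ≤
      (n:ℝ) ^ (n - 1 + 2 * g) * (n - 1 + 2 * g).factorial * SS n g m := by
  refine (union_bound g hg m hmn).trans ?_
  rw [Finset.sum_comm, SS, Finset.mul_sum]
  refine Finset.sum_le_sum fun i hi => ?_
  rw [← Finset.sum_mul, ← Finset.sum_mul]
  exact term_bound g m i (Finset.mem_range.1 hi) (by omega)

open Classical in
lemma class_sum (N : ℕ) (P : List (Equiv.Perm (Fin n)) → Prop)
    (hP : ∀ τ F, P F → P (F.map (MulAut.conj τ))) :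
    ∑ F ∈ LL n N, (if P F then chi F.prod else 0) =
      ((Finset.univ.filter (fun c : Equiv.Perm (Fin n) => IsConj (finRotate n) c)).card : ℝ) *
      (((LL n N).filter (fun F => P F ∧ F.prod = finRotate n)).card : ℝ) := by
  have h1 : ∑ F ∈ LL n N, (if P F then chi F.prod else 0) =
      (((LL n N).filter (fun F => P F ∧ IsConj (finRotate n) F.prod)).card : ℝ) := by
    rw [Finset.card_filter]
    push_cast
    refine Finset.sum_congr rfl fun F _ => ?_
    rw [chi]
    split_ifs <;> simp_all
  rw [h1]
  have h2 := Finset.card_eq_sum_card_fiberwise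
    (s := (LL n N).filter (fun F => P F ∧ IsConj (finRotate n) F.prod))
    (t := Finset.univ.filter (fun c : Equiv.Perm (Fin n) => IsConj (finRotate n) c))
    (f := fun F => F.prod) (by
      intro F hF
      simp at hF ⊢
      exact hF.2.2)
  rw [h2, Finset.sum_const_nat (m := ((LL n N).filter (fun F => P F ∧ F.prod = finRotate n)).card)]
  · push_cast; rfl
  · intro c hc
    have hc' : IsConj (finRotate n) c := by simpa using hc
    obtain ⟨τ, hτ⟩ := isConj_iff.1 hc'
    have hswap : ∀ τ : Equiv.Perm (Fin n), ∀ F ∈ LL n N, F.map (MulAut.conj τ) ∈ LL n N := by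
      intro τ F hF
      rw [mem_LL] at *
      refine ⟨by simpa using hF.1, ?_⟩
      intro t ht
      rw [List.mem_map] at ht
      obtain ⟨s, hs, rfl⟩ := ht
      obtain ⟨a, b, hab, rfl⟩ := hF.2 s hs
      refine ⟨τ a, τ b, by simpa using hab, ?_⟩
      rw [Equiv.swap_apply_apply]; rfl
    have hprod : ∀ (τ : Equiv.Perm (Fin n)) (F : List (Equiv.Perm (Fin n))),
        (F.map (MulAut.conj τ)).prod = τ * F.prod * τ⁻¹ := by
      intro τ F
      rw [← map_list_prod]; rfl
    have hinv : ∀ (τ : Equiv.Perm (Fin n)) (F : List (Equiv.Perm (Fin n))),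
        (F.map (MulAut.conj τ)).map (MulAut.conj τ⁻¹) = F := by
      intro τ F
      rw [List.map_map]
      conv_rhs => rw [← List.map_id F]
      apply List.map_congr_left
      intro t _
      simp [mul_assoc]
    refine Finset.card_bij' (fun F _ => F.map (MulAut.conj τ⁻¹)) (fun F _ => F.map (MulAut.conj τ)) ?_ ?_ ?_ ?_
    · intro F hF
      simp only [Finset.mem_filter] at hF ⊢
      refine ⟨hswap _ _ hF.1.1, hP _ _ hF.1.2.1, ?_⟩
      rw [hprod, hF.2, ← hτ]; group
    · intro F hF
      simp only [Finset.mem_filter] at hF ⊢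
      have : (F.map (MulAut.conj τ)).prod = c := by rw [hprod, hF.2.2, hτ]
      exact ⟨⟨hswap _ _ hF.1, hP _ _ hF.2.1, by rw [this]; exact hc'⟩, this⟩
    · intro F _
      have := hinv τ⁻¹ F
      rwa [inv_inv] at this
    · intro F _
      exact hinv τ F

lemma BadT_conj (m : ℕ) (τ : Equiv.Perm (Fin n)) (F : List (Equiv.Perm (Fin n))) (h : BadT m F) :
    BadT m (F.map (MulAut.conj τ)) := by
  obtain ⟨s, hs, i, v, e, he, hes, h1, h2⟩ := h
  refine ⟨s, hs, i, fun x => τ (v x), e, he, hes, fun l => ?_, ?_⟩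
  · rw [List.getElem?_map, h1 l, Equiv.swap_apply_apply]; rfl
  · rw [List.getElem?_map, h2, Equiv.swap_apply_apply]; rfl

open Classical in
lemma ncard_Fcal (g : ℕ) (Q : List (Equiv.Perm (Fin n)) → Prop) :
    Set.ncard {F | F ∈ Fcal n g ∧ Q F} =
      ((LL n (n - 1 + 2 * g)).filter (fun F => Q F.reverse ∧ F.prod = finRotate n)).card := by
  rw [← Set.ncard_coe_finset, ← Set.ncard_image_of_injective _ (List.reverse_injective)]
  congr 1
  ext F
  simp only [Set.mem_image, Set.mem_ofPred_eq, Finset.coe_filter, mem_LL, Fcal, prodLR]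
  constructor
  · rintro ⟨F, ⟨⟨h1, h2, h3⟩, h4⟩, rfl⟩
    simp_all
  · rintro ⟨⟨h1, h2⟩, h3, h4⟩
    exact ⟨F.reverse, by simp_all, by simp⟩

/-- size of the conjugacy class of the long cycle -/
noncomputable def KK (n : ℕ) : ℝ := (Set.ncard {c : Equiv.Perm (Fin n) | IsConj (finRotate n) c} : ℝ)

open Classical in
lemma class_Fcal (g : ℕ) (P : List (Equiv.Perm (Fin n)) → Prop)
    (hP : ∀ τ F, P F → P (F.map (MulAut.conj τ))) :
    ∑ F ∈ LL n (n - 1 + 2 * g), (if P F then chi F.prod else 0) =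
      KK n * (Set.ncard {F | F ∈ Fcal n g ∧ P F.reverse} : ℝ) := by
  rw [class_sum _ P hP, ncard_Fcal g (fun F => P F.reverse), KK, ← Set.ncard_coe_finset,
    ← Set.ncard_coe_finset, ← Set.ncard_coe_finset]
  simp only [List.reverse_reverse, Finset.coe_filter, Finset.mem_univ, true_and]

lemma total_Fcal (g : ℕ) :
    ∑ F ∈ LL n (n - 1 + 2 * g), chi F.prod = KK n * (Set.ncard (Fcal n g) : ℝ) := by
  have h := class_Fcal (n := n) g (fun _ => True) (fun _ _ _ => trivial)
  simpa using h

/-- the main finite estimate -/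
lemma ratio_bound (g : ℕ) (hg : 1 ≤ g) (hn : 2 ≤ n) (hng : g ≤ n - 1) (k : ℕ) (hk : k ≤ n - 1 + 2 * g)
    (hk2 : 2 * g ≤ k) :
    1 - (24 : ℝ) ^ g / ((n-1).choose g : ℝ) * SS n g (n - 1 + 2 * g - k) ≤
      (Set.ncard {F | F ∈ Fcal n g ∧ genus n (F.take k) = g} : ℝ) / (Set.ncard (Fcal n g) : ℝ) ∧
    (Set.ncard {F | F ∈ Fcal n g ∧ genus n (F.take k) = g} : ℝ) / (Set.ncard (Fcal n g) : ℝ) ≤ 1 := by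
  classical
  set N := n - 1 + 2 * g with hN
  set K := KK n
  have hK : 0 ≤ K := Nat.cast_nonneg _
  set T := (Set.ncard (Fcal n g) : ℝ) with hT
  have hT1 := total_Fcal (n := n) g
  rw [total_sum] at hT1
  have hlow := VV_lower hn g
  rw [← hN, hT1] at hlow
  have hch : (0:ℝ) < ((n-1).choose g : ℝ) := by exact_mod_cast Nat.choose_pos hng
  have hn0 : (0:ℝ) < n := by exact_mod_cast (by omega : 0 < n)
  set A := (n:ℝ) ^ N * N.factorial with hA
  have hApos : 0 < A := by positivity
  -- bad
  set B := (Set.ncard {F | F ∈ Fcal n g ∧ BadT (N - k) F.reverse} : ℝ) with hB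
  have hB1 := class_Fcal (n := n) g (fun F => BadT (N - k) F) (fun τ F h => BadT_conj _ τ F h)
  have hup := bad_bound (n := n) g hg (N - k) (by omega)
  rw [hB1] at hup
  have hKT : 0 < n * (K * T) := lt_of_lt_of_le (by positivity) hlow
  have hT0 : 0 ≤ T := Nat.cast_nonneg _
  have hTpos : 0 < T := by
    rcases hT0.lt_or_eq with h | h
    · exact h
    · rw [← h] at hKT; simp at hKT
  have hKpos : 0 < K := by
    rcases hK.lt_or_eq with h | h
    · exact h
    · rw [← h] at hKT; simp at hKT
  have hratio : B / T ≤ (24 : ℝ) ^ g / ((n-1).choose g : ℝ) * SS n g (N - k) := by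
    have h1 : B / T = (n * (K * B)) / (n * (K * T)) := by field_simp
    rw [h1]
    have hSS : 0 ≤ SS n g (N - k) := by rw [SS]; positivity
    calc (n * (K * B)) / (n * (K * T)) ≤ (A * SS n g (N - k)) / (A * (((n-1).choose g : ℝ) * (1/24) ^ g)) := by
          gcongr
      _ = _ := by
          have : (1/24 : ℝ) ^ g * 24 ^ g = 1 := by rw [← mul_pow]; norm_num
          field_simp
          rw [mul_assoc, this, mul_one]
  set Gd := (Set.ncard {F | F ∈ Fcal n g ∧ genus n (F.take k) = g} : ℝ) with hGd
  have hfin : (Fcal n g).Finite := by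
    by_contra h
    have : (Fcal n g).ncard = 0 := Set.Infinite.ncard h
    rw [hT, this] at hTpos
    simp at hTpos
  have hGT : Gd ≤ T := by
    rw [hGd, hT]
    exact_mod_cast Set.ncard_le_ncard (Set.sep_subset _ _) hfin
  have hTGB : T ≤ Gd + B := by
    have h1 : Fcal n g ⊆ {F | F ∈ Fcal n g ∧ genus n (F.take k) = g} ∪
        {F | F ∈ Fcal n g ∧ BadT (N - k) F.reverse} := by
      intro F hF
      by_cases h : genus n (F.take k) = g
      · exact Or.inl ⟨hF, h⟩
      · exact Or.inr ⟨hF, bad_of_genus g k F hF hk h⟩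
    have h2 := (Set.ncard_le_ncard h1 (Set.Finite.subset hfin (by
      rintro F (h | h) <;> exact h.1))).trans (Set.ncard_union_le _ _)
    rw [hT, hGd, hB]
    exact_mod_cast h2
  constructor
  · have : 1 - B / T ≤ Gd / T := by
      rw [sub_le_iff_le_add, ← add_div, le_div_iff₀ hTpos]; linarith
    linarith
  · exact (div_le_one hTpos).2 hGT

lemma ratio_zero (hn : 2 ≤ n) (k : ℕ) :
    (Set.ncard {F | F ∈ Fcal n 0 ∧ genus n (F.take k) = 0} : ℝ) / (Set.ncard (Fcal n 0) : ℝ) = 1 := by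
  classical
  have h1 : {F | F ∈ Fcal n 0 ∧ genus n (F.take k) = 0} = Fcal n 0 := by
    ext F
    constructor
    · exact fun h => h.1
    · intro h
      refine ⟨h, ?_⟩
      have : genus n (F.take k) ≤ 0 := Nat.sInf_le ⟨F, List.take_prefix k F, h⟩
      omega
  rw [h1, div_self]
  intro h0
  have hT1 := total_Fcal (n := n) 0
  rw [h0] at hT1
  rw [total_sum] at hT1
  have hlow := VV_lower hn 0
  rw [hT1] at hlow
  have hn0 : (0:ℝ) < n := by exact_mod_cast (by omega : 0 < n)
  have : (0:ℝ) < (n:ℝ) ^ (n - 1 + 2 * 0) * (n - 1 + 2 * 0).factorial * (((n-1).choose 0 : ℝ) * (1/24) ^ 0) := by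
    simp only [Nat.choose_zero_right, Nat.cast_one, pow_zero, mul_one]
    positivity
  simp only [mul_zero] at hlow this
  linarith

end part7

section part8

lemma geo_bound (ρ : ℝ) (h0 : 0 ≤ ρ) (h1 : ρ < 1) (q m : ℕ) :
    ∑ i ∈ Finset.range m, ρ ^ (i+1) * ((i+1 : ℕ) : ℝ) ^ q ≤ q.factorial / (1 - ρ) ^ (q+1) := by
  have hn : ‖ρ‖ < 1 := by rwa [Real.norm_eq_abs, abs_of_nonneg h0]
  have hs := hasSum_choose_mul_geometric_of_norm_lt_one q hn
  have h2 : ∑ j ∈ Finset.range (m+1), ((j + q).choose q : ℝ) * ρ ^ j ≤ 1 / (1 - ρ) ^ (q+1) :=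
    sum_le_hasSum _ (fun j _ => by positivity) hs
  have h3 : ∀ j : ℕ, (j:ℝ) ^ q ≤ q.factorial * ((j+q).choose q : ℝ) := by
    intro j
    have h4 : j ^ q ≤ q.factorial * (j+q).choose q := by
      rw [← Nat.descFactorial_eq_factorial_mul_choose]
      refine le_trans ?_ (Nat.pow_sub_le_descFactorial (j+q) q)
      exact Nat.pow_le_pow_left (by omega) _
    exact_mod_cast h4
  calc ∑ i ∈ Finset.range m, ρ ^ (i+1) * ((i+1 : ℕ) : ℝ) ^ q
      ≤ ∑ j ∈ Finset.range (m+1), ρ ^ j * (j : ℝ) ^ q := by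
        rw [Finset.sum_range_succ' _ m]
        have : 0 ≤ ρ ^ 0 * ((0:ℕ) : ℝ) ^ q := by positivity
        linarith
    _ ≤ ∑ j ∈ Finset.range (m+1), q.factorial * (((j + q).choose q : ℝ) * ρ ^ j) := by
        refine Finset.sum_le_sum fun j _ => ?_
        calc ρ ^ j * (j : ℝ) ^ q ≤ ρ ^ j * (q.factorial * ((j+q).choose q : ℝ)) := by
              gcongr; exact h3 j
          _ = _ := by ring
    _ ≤ q.factorial * (1 / (1 - ρ) ^ (q+1)) := by
        rw [← Finset.mul_sum]; gcongr
    _ = _ := by ring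

lemma SS_bound (n g k : ℕ) (hg : 1 ≤ g) (hn : 2 ≤ n) (hk0 : 0 < k) (hk : k ≤ n - 1 + 2 * g) :
    SS n g (n - 1 + 2 * g - k) ≤ (n:ℝ) ^ g * (2 ^ (g - 1) *
      (((2 * (g-1) + 1).factorial : ℝ) * ((1 + 2 * g : ℝ) ^ 2 * (Real.sqrt n / k) ^ 2) ^ g
        + (1 + 2 * g : ℝ) ^ 2 * (Real.sqrt n / k) ^ 2)) := by
  obtain ⟨p, rfl⟩ : ∃ p, g = p + 1 := ⟨g - 1, by omega⟩
  simp only [Nat.add_sub_cancel]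
  set N := n - 1 + 2 * (p + 1) with hN
  have hN0 : (0:ℝ) < N := by exact_mod_cast (by omega : 0 < N)
  have hk0' : (0:ℝ) < k := by exact_mod_cast hk0
  have hkN : (k:ℝ) ≤ N := by exact_mod_cast hk
  have hn0 : (0:ℝ) < n := by exact_mod_cast (by omega : 0 < n)
  have hNn : (N:ℝ) ≤ (1 + 2 * ((p+1 : ℕ):ℝ)) * n := by
    have : N ≤ (1 + 2 * (p+1)) * n := by
      have : 2 * (p+1) * 1 ≤ 2 * (p+1) * n := Nat.mul_le_mul_left _ (by omega)
      rw [add_mul]; omega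
    exact_mod_cast this
  set ρ := (((N - k : ℕ)):ℝ) / (N:ℝ) with hρ
  have h1ρ : 1 - ρ = k / N := by
    rw [hρ, Nat.cast_sub hk]; field_simp; ring
  have hρ0 : 0 ≤ ρ := by positivity
  have hρ1 : ρ < 1 := by
    have : 0 < 1 - ρ := by rw [h1ρ]; positivity
    linarith
  have hstep : SS n (p+1) (N - k) ≤ 2 ^ p * (∑ i ∈ Finset.range (N-k), ρ ^ (i+1) * ((i+1 : ℕ) : ℝ) ^ (2*p+1) +
      (n:ℝ) ^ p * ∑ i ∈ Finset.range (N-k), ρ ^ (i+1) * ((i+1 : ℕ) : ℝ) ^ 1) := by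
    rw [SS, Finset.mul_sum, ← Finset.sum_add_distrib, Finset.mul_sum]
    refine Finset.sum_le_sum fun i _ => ?_
    simp only [Nat.add_sub_cancel]
    rw [← hN, ← hρ]
    set j := ((i+1 : ℕ) : ℝ)
    have hj : 0 ≤ j := Nat.cast_nonneg _
    have h2 : (j^2 + n) ^ p ≤ 2 ^ p * ((j^2)^p + (n:ℝ)^p) := by
      refine (add_pow_le (by positivity) hn0.le p).trans ?_
      gcongr
      · norm_num
      · omega
    calc ρ ^ (i+1) * j * (j^2 + n) ^ p ≤ ρ ^ (i+1) * j * (2 ^ p * ((j^2)^p + (n:ℝ)^p)) := by gcongr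
      _ = _ := by ring
  have hg1 := geo_bound ρ hρ0 hρ1 (2*p+1) (N-k)
  have hg2 := geo_bound ρ hρ0 hρ1 1 (N-k)
  set y := (1 + 2 * ((p+1 : ℕ):ℝ)) ^ 2 * (Real.sqrt n / k) ^ 2 with hy
  have hxy : ((N:ℝ) / k) ^ 2 ≤ n * y := by
    rw [hy, div_pow, div_pow, Real.sq_sqrt hn0.le]
    calc (N:ℝ) ^ 2 / k ^ 2 ≤ ((1 + 2 * ((p+1 : ℕ):ℝ)) * n) ^ 2 / k ^ 2 := by gcongr
      _ = _ := by ring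
  have hinv : ∀ q : ℕ, (q.factorial : ℝ) / (1 - ρ) ^ (q+1) = q.factorial * ((N:ℝ)/k) ^ (q+1) := by
    intro q
    rw [h1ρ, div_eq_mul_inv, ← inv_pow, inv_div]
  rw [hinv] at hg1 hg2
  refine hstep.trans ?_
  calc _ ≤ 2 ^ p * (((2*p+1).factorial : ℝ) * (n * y) ^ (p+1) + (n:ℝ) ^ p * (n * y)) := by
        gcongr
        · refine hg1.trans ?_
          rw [show 2 * p + 1 + 1 = 2 * (p+1) by ring, pow_mul]
          gcongr
        · refine hg2.trans ?_
          simpa using hxy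
    _ = _ := by ring

lemma choose_bound (n g : ℕ) (hn : 2 * g ≤ n) (hn2 : 2 ≤ n) :
    (n:ℝ) ^ g ≤ 2 ^ g * g.factorial * ((n-1).choose g : ℝ) := by
  have h : n ^ g ≤ 2 ^ g * g.factorial * (n-1).choose g := by
    rw [mul_assoc, ← Nat.descFactorial_eq_factorial_mul_choose]
    calc n ^ g ≤ (2 * (n - 1 + 1 - g)) ^ g := Nat.pow_le_pow_left (by omega) _
      _ = 2 ^ g * (n - 1 + 1 - g) ^ g := mul_pow _ _ _
      _ ≤ _ := Nat.mul_le_mul_left _ (Nat.pow_sub_le_descFactorial _ _)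
  exact_mod_cast h

end part8

theorem stmt14 (g : ℕ) (k : ℕ → ℕ) (hk_le : ∀ n, k n ≤ n - 1 + 2 * g)
    (hk : Tendsto (fun n => (k n : ℝ) / Real.sqrt n) atTop atTop) :
    Tendsto (fun n =>
        (Set.ncard {F | F ∈ Fcal n g ∧ genus n (F.take (k n)) = g} : ℝ) /
          (Set.ncard (Fcal n g) : ℝ))
      atTop (nhds 1) := by
  rcases Nat.eq_zero_or_pos g with rfl | hg
  · refine tendsto_const_nhds.congr' ?_
    filter_upwards [eventually_ge_atTop 2] with n hn
    exact (ratio_zero hn (k n)).symm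
  have hk2 : ∀ᶠ n in atTop, 2 * g ≤ k n := by
    filter_upwards [hk.eventually_ge_atTop (2 * g : ℝ), eventually_ge_atTop 1] with n h1 h2
    have hs : 1 ≤ Real.sqrt n := by
      rw [Real.one_le_sqrt]; exact_mod_cast h2
    rw [le_div_iff₀ (by linarith)] at h1
    have : (2 * g : ℝ) ≤ k n := by nlinarith [(Nat.cast_nonneg g : (0:ℝ) ≤ g)]
    exact_mod_cast this
  have hinv : Tendsto (fun n : ℕ => Real.sqrt n / (k n : ℝ)) atTop (nhds 0) := by
    have := hk.inv_tendsto_atTop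
    refine this.congr fun n => ?_
    simp [inv_div]
  have hy : Tendsto (fun n : ℕ => (1 + 2 * g : ℝ) ^ 2 * (Real.sqrt n / k n) ^ 2) atTop (nhds 0) := by
    have := (hinv.pow 2).const_mul ((1 + 2 * g : ℝ) ^ 2)
    simpa using this
  have hb : Tendsto (fun n : ℕ => 1 - 24 ^ g * (2 ^ g * g.factorial) * (2 ^ (g - 1) *
      (((2 * (g-1) + 1).factorial : ℝ) * ((1 + 2 * g : ℝ) ^ 2 * (Real.sqrt n / k n) ^ 2) ^ g
        + (1 + 2 * g : ℝ) ^ 2 * (Real.sqrt n / k n) ^ 2))) atTop (nhds 1) := by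
    have h1 := ((((hy.pow g).const_mul ((2 * (g-1) + 1).factorial : ℝ)).add hy).const_mul
      ((2:ℝ) ^ (g-1))).const_mul ((24:ℝ) ^ g * (2 ^ g * g.factorial))
    have h2 := h1.const_sub 1
    have hg0 : g ≠ 0 := by omega
    simpa [hg0] using h2
  refine tendsto_of_tendsto_of_tendsto_of_le_of_le' hb tendsto_const_nhds ?_ ?_
  · filter_upwards [hk2, eventually_ge_atTop 2, eventually_ge_atTop (2 * g)] with n h1 h2 h3
    refine le_trans ?_ (ratio_bound g hg h2 (by omega) (k n) (hk_le n) h1).1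
    have hS := SS_bound n g (k n) hg h2 (by omega) (hk_le n)
    have hc := choose_bound n g h3 h2
    have hcp : (0:ℝ) < ((n-1).choose g : ℝ) := by
      exact_mod_cast Nat.choose_pos (by omega)
    gcongr 1 - ?_
    set R := (2 ^ (g - 1) *
      (((2 * (g-1) + 1).factorial : ℝ) * ((1 + 2 * g : ℝ) ^ 2 * (Real.sqrt n / k n) ^ 2) ^ g
        + (1 + 2 * g : ℝ) ^ 2 * (Real.sqrt n / k n) ^ 2)) with hR
    have hR0 : 0 ≤ R := by positivity
    calc (24 : ℝ) ^ g / ((n-1).choose g : ℝ) * SS n g (n - 1 + 2 * g - k n)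
        ≤ (24 : ℝ) ^ g / ((n-1).choose g : ℝ) * ((2 ^ g * g.factorial * ((n-1).choose g : ℝ)) * R) := by
          gcongr
          exact hS.trans (by gcongr)
      _ = _ := by field_simp
  · filter_upwards [hk2, eventually_ge_atTop 2, eventually_ge_atTop (2 * g)] with n h1 h2 h3
    exact (ratio_bound g hg h2 (by omega) (k n) (hk_le n) h1).2
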